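/- arXiv:math/0008239 — 3 statements merged into one kernel-verified Lean document; each statement's English description precedes it below -/
import Mathlib

section
/- Given six distinct lines in ℙ²(ℂ), there exists at most one smooth conic tangent to all six of them. That is, if C and D are smooth conics each tangent to all six lines, then C = D. -/
open MvPolynomial

noncomputable section

abbrev P2 : Type := Projectivization ℂ (Fin 3 → ℂ)

/-- The zero locus in `ℙ²` of a polynomial `F`: the points all of whose
representative vectors are zeros of `F`. -/
def curve (F : MvPolynomial (Fin 3) ℂ) : Set P2 :=
  {p | ∀ (w : Fin 3 → ℂ) (hw : w ≠ 0), Projectivization.mk ℂ w hw = p → eval w F = 0}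

/-- The projective line spanned by two vectors. -/
def lineThrough (u v : Fin 3 → ℂ) : Set P2 :=
  {p | ∃ s t : ℂ, ∃ h : s • u + t • v ≠ 0, p = Projectivization.mk ℂ (s • u + t • v) h}

/-- A subset of `ℙ²` is a line if it is the projective span of two
linearly independent vectors. -/
def IsLine (S : Set P2) : Prop :=
  ∃ u v : Fin 3 → ℂ, LinearIndependent ℂ ![u, v] ∧ S = lineThrough u v

/-- The restriction of `F` to the affine parametrization `t ↦ a + t • b` of the line
through `[a]` and `[b]`, as a polynomial in `t`. -/
def lineRest (F : MvPolynomial (Fin 3) ℂ) (a b : Fin 3 → ℂ) : Polynomial ℂ :=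
  eval₂ Polynomial.C (fun i => Polynomial.C (a i) + Polynomial.X * Polynomial.C (b i)) F

/-- The local intersection multiplicity, at the point `[a]`, of the curve `F = 0` with the
line through `[a]` and `[b]` (parametrized by `t ↦ a + t • b`, the point `[a]`
corresponding to `t = 0`). -/
def multAt (F : MvPolynomial (Fin 3) ℂ) (a b : Fin 3 → ℂ) : ℕ :=
  Polynomial.rootMultiplicity 0 (lineRest F a b)

/-- The scheme `X ∩ L` (for `X = {F = 0}`, `L` a line) is everywhere nonreduced: at each
point of `X ∩ L` the local intersection multiplicity is at least `2`.  (Stated over all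
parametrizations of `L`; the base point `a` of a parametrization is a point of `L`, and
every point of `L` occurs as such a base point.) -/
def EverywhereTangent (F : MvPolynomial (Fin 3) ℂ) (S : Set P2) : Prop :=
  ∀ a b : Fin 3 → ℂ, LinearIndependent ℂ ![a, b] → S = lineThrough a b →
    ∀ ha : a ≠ 0, Projectivization.mk ℂ a ha ∈ curve F → 2 ≤ multAt F a b

/-- A theta-line of the quartic `F`: either contained in the curve, or intersecting it
everywhere nonreducedly. -/
def ThetaLine (F : MvPolynomial (Fin 3) ℂ) (S : Set P2) : Prop :=
  IsLine S ∧ (S ⊆ curve F ∨ EverywhereTangent F S)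

/-- A bitangent line of (a smooth curve) `F = 0`: a line, not contained in the curve,
whose scheme-theoretic intersection with the curve is everywhere nonreduced. -/
def Bitangent (F : MvPolynomial (Fin 3) ℂ) (S : Set P2) : Prop :=
  IsLine S ∧ ¬ S ⊆ curve F ∧ EverywhereTangent F S

/-- The line `S` is tangent to the curve `F = 0` at the point `q`: the local intersection
multiplicity there is at least `2`. -/
def TangentAt (F : MvPolynomial (Fin 3) ℂ) (S : Set P2) (q : P2) : Prop :=
  IsLine S ∧ q ∈ S ∧ q ∈ curve F ∧
    ∀ a b : Fin 3 → ℂ, LinearIndependent ℂ ![a, b] → S = lineThrough a b →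
      ∀ ha : a ≠ 0, Projectivization.mk ℂ a ha = q → 2 ≤ multAt F a b

/-- The curve `F = 0` is smooth: `F` and its partial derivatives have no common
projective zero. -/
def SmoothCurve (F : MvPolynomial (Fin 3) ℂ) : Prop :=
  ∀ w : Fin 3 → ℂ, w ≠ 0 → ¬ (eval w F = 0 ∧ ∀ i : Fin 3, eval w (pderiv i F) = 0)

/-- Iterated partial derivative along a list of coordinate directions. -/
def pderivList (l : List (Fin 3)) (F : MvPolynomial (Fin 3) ℂ) : MvPolynomial (Fin 3) ℂ :=
  l.foldr (fun i G => pderiv i G) F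

/-- `F` vanishes to order at least `m` at the point `p` (all partial derivatives of
order `< m` vanish at `p`); i.e. `p` is a point of multiplicity at least `m` of `F = 0`. -/
def VanishesToOrder (F : MvPolynomial (Fin 3) ℂ) (p : P2) (m : ℕ) : Prop :=
  ∀ l : List (Fin 3), l.length < m →
    ∀ (w : Fin 3 → ℂ) (hw : w ≠ 0), Projectivization.mk ℂ w hw = p →
      eval w (pderivList l F) = 0

/-- `p` is a singular point of the curve `F = 0`. -/
def IsSingularAt (F : MvPolynomial (Fin 3) ℂ) (p : P2) : Prop :=
  VanishesToOrder F p 2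

/-- `p` is a double point: a point of multiplicity exactly `2`. -/
def IsDoublePoint (F : MvPolynomial (Fin 3) ℂ) (p : P2) : Prop :=
  VanishesToOrder F p 2 ∧ ¬ VanishesToOrder F p 3

/-- The quadratic form (in the direction `b`) cutting out the tangent cone of `F = 0`
at the double point `[a]`: the degree-`2` Taylor coefficient of `t ↦ F (a + t • b)`. -/
def coneCoeff (F : MvPolynomial (Fin 3) ℂ) (a b : Fin 3 → ℂ) : ℂ :=
  (lineRest F a b).coeff 2

/-- `p` is an ordinary node: a double point whose tangent cone consists of two distinct
lines, i.e. the tangent-cone quadratic has two null directions independent modulo `a`. -/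
def OrdinaryNode (F : MvPolynomial (Fin 3) ℂ) (p : P2) : Prop :=
  IsDoublePoint F p ∧
    ∀ (a : Fin 3 → ℂ) (ha : a ≠ 0), Projectivization.mk ℂ a ha = p →
      ∃ b₁ b₂ : Fin 3 → ℂ, LinearIndependent ℂ ![a, b₁, b₂] ∧
        coneCoeff F a b₁ = 0 ∧ coneCoeff F a b₂ = 0

/-- At the double point `[a]`, the tangent cone is the double line through `[a]` and
`[b₀]`: `b₀` is a null direction of the tangent-cone quadratic, and every null
direction lies on the line spanned by `a` and `b₀`. -/
def DoubleLineCone (F : MvPolynomial (Fin 3) ℂ) (a b₀ : Fin 3 → ℂ) : Prop :=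
  LinearIndependent ℂ ![a, b₀] ∧ coneCoeff F a b₀ = 0 ∧
    ∀ b : Fin 3 → ℂ, coneCoeff F a b = 0 → b ∈ Submodule.span ℂ ({a, b₀} : Set (Fin 3 → ℂ))

/-- `p` is an ordinary cusp: a double point whose tangent cone is a double line `L₀`
with local intersection multiplicity `i(L₀ · X) = 3` at `p`. -/
def OrdinaryCusp (F : MvPolynomial (Fin 3) ℂ) (p : P2) : Prop :=
  IsDoublePoint F p ∧
    ∀ (a : Fin 3 → ℂ) (ha : a ≠ 0), Projectivization.mk ℂ a ha = p →
      ∃ b₀ : Fin 3 → ℂ, DoubleLineCone F a b₀ ∧ multAt F a b₀ = 3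

/-- `p` is an ordinary tacnode: a double point whose tangent cone is a double line `L₀`
with local intersection multiplicity `i(L₀ · X) = 4` at `p`. -/
def OrdinaryTacnode (F : MvPolynomial (Fin 3) ℂ) (p : P2) : Prop :=
  IsDoublePoint F p ∧
    ∀ (a : Fin 3 → ℂ) (ha : a ≠ 0), Projectivization.mk ℂ a ha = p →
      ∃ b₀ : Fin 3 → ℂ, DoubleLineCone F a b₀ ∧ multAt F a b₀ = 4

/-- A theta-line of type `i`: a theta-line, not a component of the curve, containing
exactly `i` singular points of the curve. -/
def ThetaLineOfType (F : MvPolynomial (Fin 3) ℂ) (i : ℕ) (S : Set P2) : Prop :=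
  ThetaLine F S ∧ ¬ S ⊆ curve F ∧ {p | p ∈ S ∧ IsSingularAt F p}.ncard = i

/-- Three points of `ℙ²` are collinear. -/
def Collin (p q r : P2) : Prop :=
  ∃ S : Set P2, IsLine S ∧ p ∈ S ∧ q ∈ S ∧ r ∈ S


/-- An ordinary bitangent: a bitangent meeting the curve at exactly two distinct points,
each with local intersection multiplicity exactly `2`. -/
def OrdinaryBitangent (F : MvPolynomial (Fin 3) ℂ) (S : Set P2) : Prop :=
  Bitangent F S ∧ (S ∩ curve F).ncard = 2 ∧
    ∀ a b : Fin 3 → ℂ, LinearIndependent ℂ ![a, b] → S = lineThrough a b →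
      ∀ ha : a ≠ 0, Projectivization.mk ℂ a ha ∈ curve F → multAt F a b = 2

/-- A bitangent meeting the curve only at smooth points. -/
def SmoothBitangent (F : MvPolynomial (Fin 3) ℂ) (S : Set P2) : Prop :=
  Bitangent F S ∧ ∀ p ∈ S ∩ curve F, ¬ IsSingularAt F p

section TernaryForms

open Matrix

variable {K : Type*} [Field K]

/-- Conjugating a ternary bilinear form by a change of basis yields its Gram matrix. -/
lemma mul_mul_transpose_apply_eq (M : Matrix (Fin 3) (Fin 3) K) (b : Fin 3 → Fin 3 → K)
    (i j : Fin 3) : (of b * M * (of b)ᵀ) i j = b i ⬝ᵥ M *ᵥ b j := by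
  rw [Matrix.mul_assoc]
  rfl

lemma dotProduct_mulVec_comm_of_isSymm {M : Matrix (Fin 3) (Fin 3) K} (hM : M.IsSymm)
    (u v : Fin 3 → K) : u ⬝ᵥ M *ᵥ v = v ⬝ᵥ M *ᵥ u := by
  rw [dotProduct_comm, ← vecMul_transpose, hM.eq, dotProduct_mulVec]

lemma exists_eq_add_smul_of_det_eq_zero {u v w : Fin 3 → K} (huv : u ⨯₃ v ≠ 0)
    (h : (of ![u, v, w]).det = 0) : ∃ s t : K, w = s • u + t • v := by
  obtain ⟨c, hc, hcP⟩ : ∃ c ≠ 0, c ᵥ* of ![u, v, w] = 0 := exists_vecMul_eq_zero_iff.mpr h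
  have hsum : c 0 • u + c 1 • v + c 2 • w = 0 := by
    rw [← hcP]
    ext i
    simp only [vecMul, dotProduct, Fin.sum_univ_three, Pi.add_apply, Pi.smul_apply, smul_eq_mul,
      of_apply, cons_val]
  have h2 : c 2 ≠ 0 := by
    intro h2
    rw [h2, zero_smul, add_zero] at hsum
    have hind := crossProduct_ne_zero_iff_linearIndependent.mp huv
    obtain ⟨h0, h1⟩ := LinearIndependent.pair_iff.mp hind (c 0) (c 1) hsum
    apply hc
    ext i
    fin_cases i
    exacts [h0, h1, h2]
  refine ⟨-(c 0 / c 2), -(c 1 / c 2), ?_⟩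
  ext i
  have hi := congrFun hsum i
  simp only [Pi.add_apply, Pi.smul_apply, smul_eq_mul, Pi.zero_apply] at hi ⊢
  field_simp
  linear_combination hi

lemma det_of_eq_cross_dotProduct (u v w : Fin 3 → K) :
    (of ![u, v, w]).det = (u ⨯₃ v) ⬝ᵥ w := by
  simp only [cross_apply, dotProduct, Fin.sum_univ_three, det_fin_three, of_apply, cons_val]
  ring

/-- A nondegenerate ternary form has no totally isotropic plane. -/
lemma dotProduct_mulVec_ne_zero_of_isotropic {M : Matrix (Fin 3) (Fin 3) K} (hM : M.IsSymm)
    (hdet : M.det ≠ 0) {u v : Fin 3 → K} (huv : u ⨯₃ v ≠ 0)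
    (hu : u ⬝ᵥ M *ᵥ u = 0) (hv : v ⬝ᵥ M *ᵥ v = 0) : u ⬝ᵥ M *ᵥ v ≠ 0 := by
  intro h
  have h' : v ⬝ᵥ M *ᵥ u = 0 := by rw [dotProduct_mulVec_comm_of_isSymm hM, h]
  apply huv
  rw [← dotProduct_eq_zero_iff]
  intro w
  have key : (of ![u, v, w] * M * (of ![u, v, w])ᵀ).det = 0 := by
    rw [det_fin_three]
    simp only [mul_mul_transpose_apply_eq, cons_val, hu, hv, h, h']
    ring
  rw [det_mul, det_mul, det_transpose] at key
  have hP : (of ![u, v, w]).det = 0 := by simpa [hdet] using key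
  rw [← det_of_eq_cross_dotProduct, hP]

/-- Three distinct points of a smooth conic are not collinear. -/
lemma det_ne_zero_of_isotropic [NeZero (2 : K)] {M : Matrix (Fin 3) (Fin 3) K} (hM : M.IsSymm)
    (hdet : M.det ≠ 0) {u v w : Fin 3 → K} (huv : u ⨯₃ v ≠ 0) (huw : u ⨯₃ w ≠ 0)
    (hvw : v ⨯₃ w ≠ 0) (hu : u ⬝ᵥ M *ᵥ u = 0) (hv : v ⬝ᵥ M *ᵥ v = 0)
    (hw : w ⬝ᵥ M *ᵥ w = 0) : (of ![u, v, w]).det ≠ 0 := by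
  intro h
  obtain ⟨s, t, rfl⟩ := exists_eq_add_smul_of_det_eq_zero huv h
  have hb := dotProduct_mulVec_ne_zero_of_isotropic hM hdet huv hu hv
  simp only [mulVec_add, mulVec_smul, dotProduct_add, add_dotProduct, smul_dotProduct,
    dotProduct_smul, hu, hv, dotProduct_mulVec_comm_of_isSymm hM v u, smul_eq_mul] at hw
  have hst : 2 * (s * t * (u ⬝ᵥ M *ᵥ v)) = 0 := by linear_combination hw
  rcases (by simpa [hb, NeZero.ne (2 : K)] using hst : s = 0 ∨ t = 0) with rfl | rfl
  · simp at hvw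
  · simp at huw

/-- Two ternary quadratic forms without square terms that vanish at two further points in general
position are proportional. -/
lemma coeff_proportional_of_two_common_zeros {a b c a' b' c' x y z x' y' z' : K}
    (ha : a ≠ 0) (hz : z ≠ 0) (hz' : z' ≠ 0) (hxy : x * y' - x' * y ≠ 0)
    (h : a * (x * y) + b * (y * z) + c * (x * z) = 0)
    (h' : a' * (x * y) + b' * (y * z) + c' * (x * z) = 0)
    (k : a * (x' * y') + b * (y' * z') + c * (x' * z') = 0)
    (k' : a' * (x' * y') + b' * (y' * z') + c' * (x' * z') = 0) :
    b' = a' / a * b ∧ c' = a' / a * c := by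
  have e : (a * b' - a' * b) * y + (a * c' - a' * c) * x = 0 := by
    apply mul_left_cancel₀ hz
    linear_combination a * h' - a' * h
  have e' : (a * b' - a' * b) * y' + (a * c' - a' * c) * x' = 0 := by
    apply mul_left_cancel₀ hz'
    linear_combination a * k' - a' * k
  constructor
  · have : (a * b' - a' * b) * (x * y' - x' * y) = 0 := by linear_combination x * e' - x' * e
    have := (mul_eq_zero.mp this).resolve_right hxy
    field_simp
    linear_combination this
  · have : (a * c' - a' * c) * (x * y' - x' * y) = 0 := by linear_combination y' * e - y * e'
    have := (mul_eq_zero.mp this).resolve_right hxy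
    field_simp
    linear_combination this

lemma exists_coordinates {u v w : Fin 3 → K} (h : (of ![u, v, w]).det ≠ 0) (p : Fin 3 → K) :
    ∃ x y z : K, p = x • u + y • v + z • w := by
  have hp : (p ᵥ* (of ![u, v, w])⁻¹) ᵥ* of ![u, v, w] = p := by
    rw [vecMul_vecMul, nonsing_inv_mul _ (isUnit_iff_ne_zero.mpr h), vecMul_one]
  set c := p ᵥ* (of ![u, v, w])⁻¹
  refine ⟨c 0, c 1, c 2, ?_⟩
  rw [← hp]
  ext i
  simp [vecMul, dotProduct, Fin.sum_univ_three]

/-- Two smooth conics sharing five distinct points are proportional. -/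
theorem exists_eq_smul_of_five_isotropic [NeZero (2 : K)] {M N : Matrix (Fin 3) (Fin 3) K}
    (hM : M.IsSymm) (hN : N.IsSymm) (hMdet : M.det ≠ 0) (l : Fin 5 → Fin 3 → K)
    (hl : Pairwise fun i j => l i ⨯₃ l j ≠ 0)
    (hlM : ∀ i, l i ⬝ᵥ M *ᵥ l i = 0) (hlN : ∀ i, l i ⬝ᵥ N *ᵥ l i = 0) :
    ∃ k : K, N = k • M := by
  have hD {i j k : Fin 5} (hij : i ≠ j) (hik : i ≠ k) (hjk : j ≠ k) :
      (of ![l i, l j, l k]).det ≠ 0 :=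
    det_ne_zero_of_isotropic hM hMdet (hl hij) (hl hik) (hl hjk) (hlM i) (hlM j) (hlM k)
  have hP : (of ![l 0, l 1, l 2]).det ≠ 0 := hD (by decide) (by decide) (by decide)
  obtain ⟨x, y, z, h3⟩ := exists_coordinates hP (l 3)
  obtain ⟨x', y', z', h4⟩ := exists_coordinates hP (l 4)
  have expand {S : Matrix (Fin 3) (Fin 3) K} (hS : S.IsSymm)
      (hlS : ∀ i, l i ⬝ᵥ S *ᵥ l i = 0) {x y z : K} {p : Fin 3 → K}
      (hp : p = x • l 0 + y • l 1 + z • l 2) (hpS : p ⬝ᵥ S *ᵥ p = 0) :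
      (l 0 ⬝ᵥ S *ᵥ l 1) * (x * y) + (l 1 ⬝ᵥ S *ᵥ l 2) * (y * z)
        + (l 0 ⬝ᵥ S *ᵥ l 2) * (x * z) = 0 := by
    rw [hp] at hpS
    simp only [mulVec_add, mulVec_smul, dotProduct_add, add_dotProduct, smul_dotProduct,
      dotProduct_smul, hlS, dotProduct_mulVec_comm_of_isSymm hS (l 1) (l 0),
      dotProduct_mulVec_comm_of_isSymm hS (l 2) (l 0),
      dotProduct_mulVec_comm_of_isSymm hS (l 2) (l 1), smul_eq_mul] at hpS
    apply mul_left_cancel₀ (NeZero.ne (2 : K))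
    linear_combination hpS
  have third_ne_zero {i : Fin 5} (h0 : i ≠ 0) (h1 : i ≠ 1) {x y z : K}
      (hi : l i = x • l 0 + y • l 1 + z • l 2) : z ≠ 0 := by
    rintro rfl
    apply hD h0 h1 (by decide : (0 : Fin 5) ≠ 1)
    rw [hi]
    simp only [det_fin_three, of_apply, cons_val, Pi.add_apply, Pi.smul_apply, smul_eq_mul]
    ring
  have hz := third_ne_zero (by decide) (by decide) h3
  have hz' := third_ne_zero (by decide) (by decide) h4
  have hxy : x * y' - x' * y ≠ 0 := by
    intro h
    apply hD (by decide : (3 : Fin 5) ≠ 4) (by decide : (3 : Fin 5) ≠ 2) (by decide)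
    have hfac : (of ![l 3, l 4, l 2]).det = (x * y' - x' * y) * (of ![l 0, l 1, l 2]).det := by
      rw [h3, h4]
      simp only [det_fin_three, of_apply, cons_val, Pi.add_apply, Pi.smul_apply, smul_eq_mul]
      ring
    rw [hfac, h, zero_mul]
  have ha := dotProduct_mulVec_ne_zero_of_isotropic hM hMdet
    (hl (by decide : (0 : Fin 5) ≠ 1)) (hlM 0) (hlM 1)
  obtain ⟨hb, hc⟩ := coeff_proportional_of_two_common_zeros ha hz hz' hxy
    (expand hM hlM h3 (hlM 3)) (expand hN hlN h3 (hlN 3))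
    (expand hM hlM h4 (hlM 4)) (expand hN hlN h4 (hlN 4))
  set k := (l 0 ⬝ᵥ N *ᵥ l 1) / (l 0 ⬝ᵥ M *ᵥ l 1)
  have hka : l 0 ⬝ᵥ N *ᵥ l 1 = k * (l 0 ⬝ᵥ M *ᵥ l 1) := (div_mul_cancel₀ _ ha).symm
  refine ⟨k, ?_⟩
  set P := of ![l 0, l 1, l 2] with hPdef
  have hPu : IsUnit P := (isUnit_iff_isUnit_det P).mpr (isUnit_iff_ne_zero.mpr hP)
  have hPt : IsUnit Pᵀ := by
    rw [isUnit_iff_isUnit_det, det_transpose]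
    exact isUnit_iff_ne_zero.mpr hP
  have hgram : P * N * Pᵀ = P * (k • M) * Pᵀ := by
    ext i j
    rw [hPdef, mul_mul_transpose_apply_eq, mul_mul_transpose_apply_eq, smul_mulVec,
      dotProduct_smul, smul_eq_mul]
    fin_cases i <;> fin_cases j <;>
      simp [hlM, hlN, hka, hb, hc, dotProduct_mulVec_comm_of_isSymm hM (l 1) (l 0),
        dotProduct_mulVec_comm_of_isSymm hM (l 2) (l 0),
        dotProduct_mulVec_comm_of_isSymm hM (l 2) (l 1),
        dotProduct_mulVec_comm_of_isSymm hN (l 1) (l 0),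
        dotProduct_mulVec_comm_of_isSymm hN (l 2) (l 0),
        dotProduct_mulVec_comm_of_isSymm hN (l 2) (l 1)]
  exact hPu.mul_left_cancel (hPt.mul_right_cancel hgram)

/-- The determinant of the restriction of a ternary form to a plane is the value of the
adjugate form on the normal covector of that plane. -/
lemma cross_dotProduct_adjugate_mulVec_cross {A : Matrix (Fin 3) (Fin 3) K} (hA : A.IsSymm)
    (u v : Fin 3 → K) :
    (u ⨯₃ v) ⬝ᵥ A.adjugate *ᵥ (u ⨯₃ v)
      = (u ⬝ᵥ A *ᵥ u) * (v ⬝ᵥ A *ᵥ v) - (u ⬝ᵥ A *ᵥ v) ^ 2 := by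
  have h10 := hA.apply 0 1
  have h20 := hA.apply 0 2
  have h21 := hA.apply 1 2
  rw [adjugate_fin_three]
  simp only [cross_apply, mulVec, dotProduct, Fin.sum_univ_three, of_apply, cons_val, h10, h20,
    h21]
  ring

end TernaryForms

section PlaneConics

open Matrix

/-- A ternary quadratic polynomial is given by a symmetric matrix, and its gradient is twice
the associated linear map. -/
lemma exists_isSymm_of_isHomogeneous_two {F : MvPolynomial (Fin 3) ℂ} (hF : F.IsHomogeneous 2) :
    ∃ A : Matrix (Fin 3) (Fin 3) ℂ, A.IsSymm ∧ (∀ w, eval w F = w ⬝ᵥ A *ᵥ w) ∧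
      ∀ w i, eval w (pderiv i F) = 2 * (A *ᵥ w) i := by
  set A : Matrix (Fin 3) (Fin 3) ℂ := of fun i j => coeff 0 (pderiv j (pderiv i F)) / 2 with hA
  have hgrad (w : Fin 3 → ℂ) (i : Fin 3) : eval w (pderiv i F) = 2 * (A *ᵥ w) i := by
    have hconst (j : Fin 3) :
        pderiv j (pderiv i F) = C (coeff 0 (pderiv j (pderiv i F))) :=
      totalDegree_eq_zero_iff_eq_C.mp
        ((totalDegree_zero_iff_isHomogeneous _).mpr hF.pderiv.pderiv)
    have heuler := congrArg (eval w) (hF.pderiv (i := i)).sum_X_mul_pderiv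
    simp only [Nat.add_one_sub_one, one_smul, map_sum, map_mul, eval_X] at heuler
    rw [← heuler, mulVec, dotProduct, Finset.mul_sum]
    refine Finset.sum_congr rfl fun j _ => ?_
    rw [hconst j, eval_C, hA, of_apply]
    ring
  refine ⟨A, ?_, fun w => ?_, hgrad⟩
  · ext i j
    simp only [hA, transpose_apply, of_apply, coeff_pderiv, zero_add, Finsupp.coe_zero,
      Pi.zero_apply, add_comm (Finsupp.single i 1) (Finsupp.single j 1), Finsupp.single_apply,
      eq_comm (a := i) (b := j)]
  · have heuler := congrArg (eval w) hF.sum_X_mul_pderiv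
    simp only [map_sum, map_mul, eval_X, hgrad, nsmul_eq_mul, Nat.cast_ofNat, map_ofNat]
      at heuler
    apply mul_left_cancel₀ (two_ne_zero (α := ℂ))
    rw [← heuler, dotProduct, Finset.mul_sum]
    exact Finset.sum_congr rfl fun j _ => by ring

lemma SmoothCurve.det_ne_zero {F : MvPolynomial (Fin 3) ℂ} (hF : SmoothCurve F)
    {A : Matrix (Fin 3) (Fin 3) ℂ} (hA : ∀ w, eval w F = w ⬝ᵥ A *ᵥ w)
    (hgrad : ∀ w i, eval w (pderiv i F) = 2 * (A *ᵥ w) i) : A.det ≠ 0 := by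
  intro h
  obtain ⟨w, hw, hAw⟩ := exists_mulVec_eq_zero_iff.mpr h
  exact hF w hw ⟨by simp [hA, hAw], fun i => by simp [hgrad, hAw]⟩

lemma mk_mem_curve_iff {F : MvPolynomial (Fin 3) ℂ} {A : Matrix (Fin 3) (Fin 3) ℂ}
    (hA : ∀ w, eval w F = w ⬝ᵥ A *ᵥ w) {w : Fin 3 → ℂ} (hw : w ≠ 0) :
    Projectivization.mk ℂ w hw ∈ curve F ↔ w ⬝ᵥ A *ᵥ w = 0 := by
  refine ⟨fun h => hA w ▸ h w hw rfl, fun h v hv hvw => ?_⟩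
  obtain ⟨a, rfl⟩ := (Projectivization.mk_eq_mk_iff' ℂ v w hv hw).mp hvw
  simp [hA, mulVec_smul, h]

lemma mk_mem_lineThrough_iff {u v w : Fin 3 → ℂ} (huv : u ⨯₃ v ≠ 0) (hw : w ≠ 0) :
    Projectivization.mk ℂ w hw ∈ lineThrough u v ↔ (u ⨯₃ v) ⬝ᵥ w = 0 := by
  constructor
  · rintro ⟨s, t, h, hmk⟩
    obtain ⟨a, rfl⟩ := (Projectivization.mk_eq_mk_iff' ℂ _ _ hw h).mp hmk
    simp [dotProduct_comm (u ⨯₃ v), add_dotProduct, smul_dotProduct]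
  · intro h
    rw [← det_of_eq_cross_dotProduct] at h
    obtain ⟨s, t, rfl⟩ := exists_eq_add_smul_of_det_eq_zero huv h
    exact ⟨s, t, hw, rfl⟩

lemma cross_cross_ne_zero_of_lineThrough_ne {u v u' v' : Fin 3 → ℂ} (huv : u ⨯₃ v ≠ 0)
    (huv' : u' ⨯₃ v' ≠ 0) (h : lineThrough u v ≠ lineThrough u' v') :
    (u ⨯₃ v) ⨯₃ (u' ⨯₃ v') ≠ 0 := by
  rw [crossProduct_ne_zero_iff_linearIndependent, LinearIndependent.pair_iff' huv]
  intro a ha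
  have ha0 : a ≠ 0 := by
    rintro rfl
    exact huv' (by rw [← ha, zero_smul])
  apply h
  ext p
  induction p using Projectivization.ind with | h w hw =>
  rw [mk_mem_lineThrough_iff huv, mk_mem_lineThrough_iff huv', ← ha, smul_dotProduct,
    smul_eq_zero_iff_right ha0]

/-- A binary quadratic form with nonzero discriminant has two non-proportional zeros. -/
lemma exists_two_zeros_of_discrim_ne_zero {a b c : ℂ} (h : b ^ 2 - a * c ≠ 0) :
    ∃ s t s' t' : ℂ, s * t' - s' * t ≠ 0 ∧ a * s ^ 2 + 2 * b * (s * t) + c * t ^ 2 = 0 ∧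
      a * s' ^ 2 + 2 * b * (s' * t') + c * t' ^ 2 = 0 := by
  obtain ⟨d, hd⟩ := IsAlgClosed.exists_pow_nat_eq (b ^ 2 - a * c) two_pos
  by_cases ha : a = 0
  · subst ha
    refine ⟨1, 0, c, -2 * b, ?_, by ring, by ring⟩
    have hb : b ≠ 0 := by
      rintro rfl
      simp at h
    simpa using hb
  · refine ⟨-b + d, a, -b - d, a, ?_, ?_, ?_⟩
    · have hd0 : d ≠ 0 := by
        rintro rfl
        exact h (by simpa using hd.symm)
      have : (-b + d) * a - (-b - d) * a = 2 * d * a := by ring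
      rw [this]
      exact mul_ne_zero (mul_ne_zero two_ne_zero hd0) ha
    · linear_combination a * hd
    · linear_combination a * hd

/-- The restriction of a conic to a line meeting it in exactly one point has vanishing
discriminant. -/
lemma conic_discrim_eq_zero_of_existsUnique {F : MvPolynomial (Fin 3) ℂ}
    {A : Matrix (Fin 3) (Fin 3) ℂ} (hAs : A.IsSymm) (hA : ∀ w, eval w F = w ⬝ᵥ A *ᵥ w)
    {u v : Fin 3 → ℂ} (huv : LinearIndependent ℂ ![u, v])
    (hF : ∃! p : P2, p ∈ curve F ∩ lineThrough u v) :
    (u ⬝ᵥ A *ᵥ v) ^ 2 - (u ⬝ᵥ A *ᵥ u) * (v ⬝ᵥ A *ᵥ v) = 0 := by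
  by_contra hdisc
  obtain ⟨s, t, s', t', hne, h, h'⟩ := exists_two_zeros_of_discrim_ne_zero hdisc
  have hind := LinearIndependent.pair_iff.mp huv
  have vec_ne_zero {s t : ℂ} (hst : ¬(s = 0 ∧ t = 0)) : s • u + t • v ≠ 0 :=
    fun h0 => hst (hind s t h0)
  have mem {s t : ℂ} (hst : s • u + t • v ≠ 0)
      (h : (u ⬝ᵥ A *ᵥ u) * s ^ 2 + 2 * (u ⬝ᵥ A *ᵥ v) * (s * t)
        + (v ⬝ᵥ A *ᵥ v) * t ^ 2 = 0) :
      Projectivization.mk ℂ _ hst ∈ curve F ∩ lineThrough u v := by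
    refine ⟨(mk_mem_curve_iff hA hst).mpr ?_, s, t, hst, rfl⟩
    simp only [mulVec_add, mulVec_smul, dotProduct_add, add_dotProduct, smul_dotProduct,
      dotProduct_smul, dotProduct_mulVec_comm_of_isSymm hAs v u, smul_eq_mul]
    linear_combination h
  have h0 : s • u + t • v ≠ 0 := vec_ne_zero (by rintro ⟨rfl, rfl⟩; simp at hne)
  have h0' : s' • u + t' • v ≠ 0 := vec_ne_zero (by rintro ⟨rfl, rfl⟩; simp at hne)
  obtain ⟨k, hk⟩ := (Projectivization.mk_eq_mk_iff' ℂ _ _ h0 h0').mp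
    (hF.unique (mem h0 h) (mem h0' h'))
  obtain ⟨hs, ht⟩ := hind (k * s' - s) (k * t' - t) (by
    rw [← sub_eq_zero] at hk
    rw [← hk]
    module)
  apply hne
  linear_combination s' * ht - t' * hs

end PlaneConics

/-- Given six distinct lines in `ℙ²`, there is at most one smooth
conic tangent to all six of them. -/
theorem at_most_one_conic_tangent_to_six_lines
    (L : Fin 6 → Set P2) (hline : ∀ i, IsLine (L i))
    (hdist : ∀ i j : Fin 6, i ≠ j → L i ≠ L j)
    (Q R : MvPolynomial (Fin 3) ℂ)
    (hQ0 : Q ≠ 0) (hQ2 : Q.IsHomogeneous 2) (hQsm : SmoothCurve Q)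
    (hR0 : R ≠ 0) (hR2 : R.IsHomogeneous 2) (hRsm : SmoothCurve R)
    (hQt : ∀ i : Fin 6, ∃! p : P2, p ∈ curve Q ∩ L i)
    (hRt : ∀ i : Fin 6, ∃! p : P2, p ∈ curve R ∩ L i) :
    curve Q = curve R := by
  choose u v huv hL using hline
  have hn (i) := crossProduct_ne_zero_iff_linearIndependent.mpr (huv i)
  obtain ⟨A, hAs, hA, hAgrad⟩ := exists_isSymm_of_isHomogeneous_two hQ2
  obtain ⟨B, hBs, hB, hBgrad⟩ := exists_isSymm_of_isHomogeneous_two hR2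
  have hAdet := hQsm.det_ne_zero hA hAgrad
  have hBdet := hRsm.det_ne_zero hB hBgrad
  have hdual {F : MvPolynomial (Fin 3) ℂ} {S : Matrix (Fin 3) (Fin 3) ℂ} (hSs : S.IsSymm)
      (hS : ∀ w, eval w F = w ⬝ᵥ S.mulVec w) (hFt : ∀ i, ∃! p : P2, p ∈ curve F ∩ L i) (i) :
      crossProduct (u i) (v i) ⬝ᵥ S.adjugate.mulVec (crossProduct (u i) (v i)) = 0 := by
    rw [cross_dotProduct_adjugate_mulVec_cross hSs]
    linear_combination -conic_discrim_eq_zero_of_existsUnique hSs hS (huv i) (hL i ▸ hFt i)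
  have hadj : A.adjugate.det ≠ 0 := by
    rw [Matrix.det_adjugate]
    exact pow_ne_zero _ hAdet
  obtain ⟨k, hk⟩ := exists_eq_smul_of_five_isotropic (M := A.adjugate) (N := B.adjugate)
    hAs.adjugate hBs.adjugate hadj
    (fun i : Fin 5 => crossProduct (u i.castSucc) (v i.castSucc))
    (fun i j hij => cross_cross_ne_zero_of_lineThrough_ne (hn _) (hn _)
      (by rw [← hL, ← hL]; exact hdist _ _ (by simpa using hij)))
    (fun i => hdual hAs hA hQt _) (fun i => hdual hBs hB hRt _)
  have hprop : B.det • A = (k * A.det) • B := by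
    calc B.det • A = A * (B.adjugate * B) := by
          rw [Matrix.adjugate_mul, Matrix.mul_smul, Matrix.mul_one]
      _ = (k * A.det) • B := by
          rw [hk, Matrix.smul_mul, Matrix.mul_smul, ← Matrix.mul_assoc, Matrix.mul_adjugate,
            Matrix.smul_mul, Matrix.one_mul, smul_smul]
  have hk0 : k * A.det ≠ 0 := by
    intro h0
    rw [h0, zero_smul, smul_eq_zero_iff_right hBdet] at hprop
    exact hAdet (by simp [hprop])
  ext p
  induction p using Projectivization.ind with | h w hw =>
  have hw' := congrArg (fun S : Matrix (Fin 3) (Fin 3) ℂ => w ⬝ᵥ S.mulVec w) hprop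
  simp only [Matrix.smul_mulVec, dotProduct_smul] at hw'
  rw [mk_mem_curve_iff hA, mk_mem_curve_iff hB, ← smul_eq_zero_iff_right hBdet, hw',
    smul_eq_zero_iff_right hk0]


end
end

section
/- Two smooth conics in ℙ²(ℂ) that intersect transversally in four distinct points have exactly four distinct common tangent lines. -/
open MvPolynomial

noncomputable section

lemma pderiv_pderiv_comm {R σ : Type*} [CommRing R] (i j : σ) (F : MvPolynomial σ R) :
    pderiv i (pderiv j F) = pderiv j (pderiv i F) := by
  classical
  have h : ⁅pderiv (R := R) i, pderiv (R := R) j⁆ = 0 := by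
    apply MvPolynomial.derivation_ext
    intro k
    simp [Derivation.commutator_apply, pderiv_X, Pi.single_apply, apply_ite]
  have := congrArg (fun D => D F) h
  simpa [Derivation.commutator_apply, sub_eq_zero] using this

/-- A ternary quadratic form is half the diagonal of a symmetric bilinear form, whose radical is
trivial when the conic is smooth. -/
lemma exists_bilinForm_of_smoothCurve {F : MvPolynomial (Fin 3) ℂ} (hF : F.IsHomogeneous 2)
    (hsm : SmoothCurve F) :
    ∃ B : LinearMap.BilinForm ℂ (Fin 3 → ℂ), (∀ u v, B u v = B v u) ∧
      (∀ w, 2 * eval w F = B w w) ∧ ∀ w, (∀ v, B w v = 0) → w = 0 := by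
  have hconst : ∀ i j, ∃ c : ℂ, pderiv j (pderiv i F) = C c := fun i j =>
    ⟨_, totalDegree_eq_zero_iff_eq_C.mp
      ((totalDegree_zero_iff_isHomogeneous _).mpr (hF.pderiv.pderiv (i := j)))⟩
  choose c hc using hconst
  have hsymm : ∀ i j, c i j = c j i := fun i j =>
    C_injective _ _ (by rw [← hc, ← hc, pderiv_pderiv_comm])
  have hgrad : ∀ (w : Fin 3 → ℂ) i, eval w (pderiv i F) = ∑ j, w j * c i j := by
    intro w i
    have := congrArg (eval w) (hF.pderiv (i := i)).sum_X_mul_pderiv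
    simpa [hc] using this.symm
  have heuler : ∀ w : Fin 3 → ℂ, 2 * eval w F = ∑ i, w i * ∑ j, w j * c i j := by
    intro w
    have := congrArg (eval w) hF.sum_X_mul_pderiv
    simpa [hgrad] using this.symm
  refine ⟨Matrix.toBilin' (Matrix.of c), ?_, ?_, ?_⟩
  · intro u v
    simp only [Matrix.toBilin'_apply, Fin.sum_univ_three, Matrix.of_apply]
    rw [hsymm 1 0, hsymm 2 0, hsymm 2 1]
    ring
  · intro w
    rw [heuler]
    simp only [Matrix.toBilin'_apply, Fin.sum_univ_three, Matrix.of_apply]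
    ring
  · intro w hw
    by_contra hw0
    have hg : ∀ i, eval w (pderiv i F) = 0 := by
      intro i
      have := hw (Pi.single i 1)
      rw [hgrad]
      simp only [Matrix.toBilin'_apply, Matrix.of_apply, Pi.single_apply, mul_ite, mul_one,
        mul_zero, Finset.sum_ite_eq', Finset.mem_univ, if_true] at this
      simpa only [hsymm i] using this
    refine hsm w hw0 ⟨?_, hg⟩
    have := heuler w
    simp only [← hgrad, hg, mul_zero, Finset.sum_const_zero] at this
    simpa using this

lemma linearIndependent_triple_of_notMem_span {K V : Type*} [Field K] [AddCommGroup V] [Module K V]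
    {u v w : V} (huv : LinearIndependent K ![u, v]) (hw : w ∉ Submodule.span K {u, v}) :
    LinearIndependent K ![w, u, v] := by
  refine linearIndependent_finCons.mpr ⟨huv, ?_⟩
  simpa [Matrix.range_cons, Set.pair_comm] using hw

/-- A nondegenerate symmetric bilinear form in three variables has no totally isotropic plane. -/
lemma bilin_ne_zero_of_isotropic {B : LinearMap.BilinForm ℂ (Fin 3 → ℂ)}
    (hsymm : ∀ u v, B u v = B v u) (hnd : ∀ w, (∀ v, B w v = 0) → w = 0)
    {u v : Fin 3 → ℂ} (huv : LinearIndependent ℂ ![u, v]) (hu : B u u = 0) (hv : B v v = 0) :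
    B u v ≠ 0 := by
  intro h
  obtain ⟨c, hc⟩ : ∃ c, c ∉ Submodule.span ℂ {u, v} := by
    by_contra! hall
    have htop : Submodule.span ℂ (Set.range ![u, v]) = ⊤ := by
      rw [eq_top_iff]
      intro x _
      simpa [Matrix.range_cons, Set.pair_comm] using hall x
    have h1 := finrank_span_eq_card huv
    rw [htop, finrank_top] at h1
    simp at h1
  have hli := linearIndependent_triple_of_notMem_span huv hc
  let e := basisOfLinearIndependentOfCardEqFinrank hli (by simp)
  have hker : ∀ w, B w c = 0 → B w u = 0 → B w v = 0 → w = 0 := by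
    intro w h0 h1 h2
    have : B w = 0 := by
      apply e.ext
      intro i
      fin_cases i <;> simp [e, h0, h1, h2]
    exact hnd w fun x => by simp [this]
  have hw := hker (B v c • u - B u c • v) (by simp; ring) (by simp [hu, hsymm v u, h])
    (by simp [hv, h])
  have hcoef := LinearIndependent.pair_iff.mp huv (B v c) (-B u c) (by
    rw [← hw]; module)
  exact huv.ne_zero 0 (hker u (by simpa using hcoef.2) hu h)

lemma linearIndependent_of_isotropic {B : LinearMap.BilinForm ℂ (Fin 3 → ℂ)}
    (hsymm : ∀ u v, B u v = B v u) (hnd : ∀ w, (∀ v, B w v = 0) → w = 0)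
    {u v w : Fin 3 → ℂ} (hu : B u u = 0) (hv : B v v = 0) (hw : B w w = 0)
    (huv : LinearIndependent ℂ ![u, v]) (huw : LinearIndependent ℂ ![u, w])
    (hvw : LinearIndependent ℂ ![v, w]) :
    LinearIndependent ℂ ![w, u, v] := by
  refine linearIndependent_triple_of_notMem_span huv fun hmem => ?_
  obtain ⟨s, t, rfl⟩ := Submodule.mem_span_pair.mp hmem
  have hst : s * t * B u v = 0 := by
    simp [hu, hv, hsymm v u] at hw
    grind
  rcases mul_eq_zero.mp hst with h | h
  · rcases mul_eq_zero.mp h with rfl | rfl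
    · have := LinearIndependent.pair_iff.mp hvw t (-1) (by module)
      simp at this
    · have := LinearIndependent.pair_iff.mp huw s (-1) (by module)
      simp at this
  · exact bilin_ne_zero_of_isotropic hsymm hnd huv hu hv h

lemma linearIndependent_triple_iff {K V : Type*} [Field K] [AddCommGroup V] [Module K V]
    {u v w : V} : LinearIndependent K ![u, v, w] ↔
      ∀ x y z : K, x • u + y • v + z • w = 0 → x = 0 ∧ y = 0 ∧ z = 0 := by
  rw [Fintype.linearIndependent_iff]
  refine ⟨fun h x y z hxyz => ?_, fun h g hg => ?_⟩
  · have := h ![x, y, z] (by simpa [Fin.sum_univ_three] using hxyz)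
    exact ⟨this 0, this 1, this 2⟩
  · obtain ⟨h0, h1, h2⟩ := h (g 0) (g 1) (g 2) (by simpa [Fin.sum_univ_three] using hg)
    intro i
    fin_cases i <;> assumption

/-- Four vectors of a three-dimensional space, any three of which are independent, can be rescaled
so that the last one is the sum of the other three. -/
lemma exists_smul_add_smul_add_smul_eq {v₀ v₁ v₂ v₃ : Fin 3 → ℂ}
    (h012 : LinearIndependent ℂ ![v₀, v₁, v₂]) (h312 : LinearIndependent ℂ ![v₃, v₁, v₂])
    (h302 : LinearIndependent ℂ ![v₃, v₀, v₂]) (h301 : LinearIndependent ℂ ![v₃, v₀, v₁]) :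
    ∃ x y z : ℂ, x ≠ 0 ∧ y ≠ 0 ∧ z ≠ 0 ∧ x • v₀ + y • v₁ + z • v₂ = v₃ := by
  let e := basisOfLinearIndependentOfCardEqFinrank h012 (by simp)
  have hsum := e.sum_equivFun v₃
  simp only [Fin.sum_univ_three, e, coe_basisOfLinearIndependentOfCardEqFinrank,
    Matrix.cons_val_zero, Matrix.cons_val_one, Matrix.cons_val] at hsum
  set x := e.equivFun v₃ 0
  set y := e.equivFun v₃ 1
  set z := e.equivFun v₃ 2
  refine ⟨x, y, z, fun h => ?_, fun h => ?_, fun h => ?_, hsum⟩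
  · have := linearIndependent_triple_iff.mp h312 (-1) y z (by rw [← hsum, h]; module)
    simp at this
  · have := linearIndependent_triple_iff.mp h302 (-1) x z (by rw [← hsum, h]; module)
    simp at this
  · have := linearIndependent_triple_iff.mp h301 (-1) x y (by rw [← hsum, h]; module)
    simp at this

lemma linearIndependent_pairwise_sums {p₀ p₁ p₂ : Fin 3 → ℂ}
    (h : LinearIndependent ℂ ![p₀, p₁, p₂]) :
    LinearIndependent ℂ ![p₁ + p₂, p₀ + p₂, p₀ + p₁] := by
  rw [linearIndependent_triple_iff] at h ⊢
  intro x y z hxyz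
  obtain ⟨h0, h1, h2⟩ := h (y + z) (x + z) (x + y) (by rw [← hxyz]; module)
  refine ⟨?_, ?_, ?_⟩
  · linear_combination (h1 + h2 - h0) / 2
  · linear_combination (h0 + h2 - h1) / 2
  · linear_combination (h0 + h1 - h2) / 2

/-- If `p₀`, `p₁`, `p₂` and `p₀ + p₁ + p₂` are isotropic, then the pairwise sums of `p₀`, `p₁`, `p₂`
are pairwise orthogonal. -/
lemma bilin_self_pairwise_sums {B : LinearMap.BilinForm ℂ (Fin 3 → ℂ)}
    (hsymm : ∀ u v, B u v = B v u) {p₀ p₁ p₂ : Fin 3 → ℂ} (h₀ : B p₀ p₀ = 0) (h₁ : B p₁ p₁ = 0)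
    (h₂ : B p₂ p₂ = 0) (hsum : B p₀ p₁ + B p₀ p₂ + B p₁ p₂ = 0) (x y z : ℂ) :
    B (x • (p₁ + p₂) + y • (p₀ + p₂) + z • (p₀ + p₁))
      (x • (p₁ + p₂) + y • (p₀ + p₂) + z • (p₀ + p₁)) =
      2 * (B p₁ p₂ * x ^ 2 + B p₀ p₂ * y ^ 2 + B p₀ p₁ * z ^ 2) := by
  simp only [map_add, map_smul, LinearMap.add_apply, LinearMap.smul_apply, smul_eq_mul, h₀, h₁, h₂,
    hsymm p₁ p₀, hsymm p₂ p₀, hsymm p₂ p₁]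
  linear_combination (2 * x * y + 2 * x * z + 2 * y * z) * hsum

lemma eval_smul_of_isHomogeneous {R σ : Type*} [CommRing R] [Fintype σ] {F : MvPolynomial σ R}
    {n : ℕ} (hF : F.IsHomogeneous n) (k : R) (w : σ → R) :
    eval (k • w) F = k ^ n * eval w F := by
  rw [eval_eq', eval_eq', Finset.mul_sum]
  refine Finset.sum_congr rfl fun d hd => ?_
  have hdeg : ∑ i, d i = n := by
    simpa [Finsupp.weight_apply, Finsupp.sum_fintype] using hF (mem_support_iff.mp hd)
  simp only [Pi.smul_apply, smul_eq_mul, mul_pow, Finset.prod_mul_distrib,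
    Finset.prod_pow_eq_pow_sum, hdeg]
  ring

lemma mk_mem_curve {F : MvPolynomial (Fin 3) ℂ} {n : ℕ} (hF : F.IsHomogeneous n)
    {w : Fin 3 → ℂ} (hw : w ≠ 0) : Projectivization.mk ℂ w hw ∈ curve F ↔ eval w F = 0 := by
  refine ⟨fun h => h w hw rfl, fun h v hv hvw => ?_⟩
  obtain ⟨k, rfl⟩ := (Projectivization.mk_eq_mk_iff' ℂ _ _ hv hw).mp hvw
  rw [eval_smul_of_isHomogeneous hF, h, mul_zero]

lemma mem_curve_iff {F : MvPolynomial (Fin 3) ℂ} {n : ℕ} (hF : F.IsHomogeneous n) (p : P2) :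
    p ∈ curve F ↔ eval p.rep F = 0 := by
  rw [← mk_mem_curve hF p.rep_nonzero, p.mk_rep]

lemma linearIndependent_rep_pair {p q : P2} (h : p ≠ q) :
    LinearIndependent ℂ ![p.rep, q.rep] := by
  rw [← Projectivization.independent_mk_iff_LinearIndependent p.rep_nonzero q.rep_nonzero]
  simpa using h

/-- Two smooth conics with exactly four common points are simultaneously diagonal in suitable
coordinates, with coefficients summing to zero; the common points avoid a coordinate line. -/
lemma exists_simultaneous_diagonalization {Q R : MvPolynomial (Fin 3) ℂ}
    (hQ2 : Q.IsHomogeneous 2) (hQsm : SmoothCurve Q)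
    (hR2 : R.IsHomogeneous 2) (hRsm : SmoothCurve R) (hmeet : (curve Q ∩ curve R).ncard = 4) :
    ∃ (T : (Fin 3 → ℂ) ≃ₗ[ℂ] (Fin 3 → ℂ)) (a b : Fin 3 → ℂ),
      (∀ w, eval w Q = a 0 * T w 0 ^ 2 + a 1 * T w 1 ^ 2 + a 2 * T w 2 ^ 2) ∧
      (∀ w, eval w R = b 0 * T w 0 ^ 2 + b 1 * T w 1 ^ 2 + b 2 * T w 2 ^ 2) ∧
      a 0 + a 1 + a 2 = 0 ∧ b 0 + b 1 + b 2 = 0 ∧ (∀ i, a i ≠ 0) ∧ (∀ i, b i ≠ 0) ∧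
      ∀ p ∈ curve Q ∩ curve R, T p.rep 0 ≠ 0 := by
  obtain ⟨q₀, q₁, q₂, q₃, h01, h02, h03, h12, h13, h23, hset⟩ := Set.ncard_eq_four.mp hmeet
  obtain ⟨B, hBs, hBQ, hBn⟩ := exists_bilinForm_of_smoothCurve hQ2 hQsm
  obtain ⟨D, hDs, hDR, hDn⟩ := exists_bilinForm_of_smoothCurve hR2 hRsm
  have hiso : ∀ q ∈ curve Q ∩ curve R, B q.rep q.rep = 0 ∧ D q.rep q.rep = 0 := by
    rintro q ⟨hq, hr⟩
    rw [mem_curve_iff hQ2] at hq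
    rw [mem_curve_iff hR2] at hr
    rw [← hBQ, ← hDR, hq, hr]
    simp
  obtain ⟨hB0, hD0⟩ := hiso q₀ (by simp [hset])
  obtain ⟨hB1, hD1⟩ := hiso q₁ (by simp [hset])
  obtain ⟨hB2, hD2⟩ := hiso q₂ (by simp [hset])
  obtain ⟨hB3, hD3⟩ := hiso q₃ (by simp [hset])
  have hli : ∀ {u v w : P2}, u ≠ v → u ≠ w → v ≠ w → B u.rep u.rep = 0 → B v.rep v.rep = 0 →
      B w.rep w.rep = 0 → LinearIndependent ℂ ![w.rep, u.rep, v.rep] :=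
    fun huv huw hvw hu hv hw => linearIndependent_of_isotropic hBs hBn hu hv hw
      (linearIndependent_rep_pair huv) (linearIndependent_rep_pair huw)
      (linearIndependent_rep_pair hvw)
  have h012 := hli h12 h01.symm h02.symm hB1 hB2 hB0
  obtain ⟨x, y, z, hx, hy, hz, hxyz⟩ := exists_smul_add_smul_add_smul_eq h012
    (hli h12 h13 h23 hB1 hB2 hB3) (hli h02 h03 h23 hB0 hB2 hB3) (hli h01 h03 h13 hB0 hB1 hB3)
  set p₀ := x • q₀.rep with hp₀
  set p₁ := y • q₁.rep with hp₁
  set p₂ := z • q₂.rep with hp₂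
  have hp : LinearIndependent ℂ ![p₀, p₁, p₂] := by
    rw [linearIndependent_triple_iff] at h012 ⊢
    intro r s t h
    simpa [hx, hy, hz] using h012 (r * x) (s * y) (t * z) (by rw [← h]; module)
  have hp01 : LinearIndependent ℂ ![p₀, p₁] :=
    LinearIndependent.pair_iff.mpr fun s t h =>
      have := linearIndependent_triple_iff.mp hp s t 0 (by simpa using h)
      ⟨this.1, this.2.1⟩
  have hp02 : LinearIndependent ℂ ![p₀, p₂] :=
    LinearIndependent.pair_iff.mpr fun s t h =>
      have := linearIndependent_triple_iff.mp hp s 0 t (by simpa using h)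
      ⟨this.1, this.2.2⟩
  have hp12 : LinearIndependent ℂ ![p₁, p₂] :=
    LinearIndependent.pair_iff.mpr fun s t h =>
      have := linearIndependent_triple_iff.mp hp 0 s t (by simpa using h)
      this.2
  let e := basisOfLinearIndependentOfCardEqFinrank (linearIndependent_pairwise_sums hp) (by simp)
  have hcoord : ∀ w, w = e.equivFun w 0 • (p₁ + p₂) + e.equivFun w 1 • (p₀ + p₂) +
      e.equivFun w 2 • (p₀ + p₁) := by
    intro w
    conv_lhs => rw [← e.sum_equivFun w]
    simp [Fin.sum_univ_three, e]
  have hdiag : ∀ {C : LinearMap.BilinForm ℂ (Fin 3 → ℂ)}, (∀ u v, C u v = C v u) →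
      (∀ w, (∀ v, C w v = 0) → w = 0) → C q₀.rep q₀.rep = 0 → C q₁.rep q₁.rep = 0 →
      C q₂.rep q₂.rep = 0 → C q₃.rep q₃.rep = 0 → ∃ a : Fin 3 → ℂ,
      (∀ w, C w w = 2 * (a 0 * e.equivFun w 0 ^ 2 + a 1 * e.equivFun w 1 ^ 2 +
        a 2 * e.equivFun w 2 ^ 2)) ∧ a 0 + a 1 + a 2 = 0 ∧ ∀ i, a i ≠ 0 := by
    intro C hs hn h0 h1 h2 h3
    replace h0 : C p₀ p₀ = 0 := by simp [hp₀, h0]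
    replace h1 : C p₁ p₁ = 0 := by simp [hp₁, h1]
    replace h2 : C p₂ p₂ = 0 := by simp [hp₂, h2]
    have hsum : C p₀ p₁ + C p₀ p₂ + C p₁ p₂ = 0 := by
      rw [← hxyz] at h3
      simp only [map_add, LinearMap.add_apply, h0, h1, h2, hs p₁ p₀, hs p₂ p₀, hs p₂ p₁] at h3
      linear_combination h3 / 2
    refine ⟨![C p₁ p₂, C p₀ p₂, C p₀ p₁], fun w => ?_, ?_, ?_⟩
    · conv_lhs => rw [hcoord w]
      exact bilin_self_pairwise_sums hs h0 h1 h2 hsum _ _ _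
    · simp
      linear_combination hsum
    · intro i
      fin_cases i
      · exact bilin_ne_zero_of_isotropic hs hn hp12 h1 h2
      · exact bilin_ne_zero_of_isotropic hs hn hp02 h0 h2
      · exact bilin_ne_zero_of_isotropic hs hn hp01 h0 h1
  obtain ⟨a, haQ, ha, ha0⟩ := hdiag hBs hBn hB0 hB1 hB2 hB3
  obtain ⟨b, hbR, hb, hb0⟩ := hdiag hDs hDn hD0 hD1 hD2 hD3
  refine ⟨e.equivFun, a, b, fun w => ?_, fun w => ?_, ha, hb, ha0, hb0, ?_⟩
  · exact mul_left_cancel₀ two_ne_zero (by rw [hBQ, haQ])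
  · exact mul_left_cancel₀ two_ne_zero (by rw [hDR, hbR])
  · have hc0 : e.coord 0 p₁ + e.coord 0 p₂ = 1 := by
      rw [← map_add]
      simpa [e] using e.repr_self_apply 0 0
    have hc1 : e.coord 0 p₀ + e.coord 0 p₂ = 0 := by
      rw [← map_add]
      simpa [e] using e.repr_self_apply 1 0
    have hc2 : e.coord 0 p₀ + e.coord 0 p₁ = 0 := by
      rw [← map_add]
      simpa [e] using e.repr_self_apply 2 0
    have hc3 : e.coord 0 q₃.rep = e.coord 0 p₀ + e.coord 0 p₁ + e.coord 0 p₂ := by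
      rw [← hxyz, map_add, map_add]
    simp only [hp₀, hp₁, hp₂, map_smul, smul_eq_mul] at hc0 hc1 hc2 hc3
    rw [hset]
    intro p hp h
    change e.coord 0 p.rep = 0 at h
    simp only [Set.mem_insert_iff, Set.mem_singleton_iff] at hp
    rcases hp with rfl | rfl | rfl | rfl <;> grind

/-- The line in `ℙ²` whose equation in the linear coordinates `T` has coefficients `l`. -/
def coordLine (T : (Fin 3 → ℂ) ≃ₗ[ℂ] (Fin 3 → ℂ)) (l : Fin 3 → ℂ) : Set P2 :=
  {p | l 0 * T p.rep 0 + l 1 * T p.rep 1 + l 2 * T p.rep 2 = 0}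

lemma mk_mem_coordLine {T : (Fin 3 → ℂ) ≃ₗ[ℂ] (Fin 3 → ℂ)} {l w : Fin 3 → ℂ} (hw : w ≠ 0) :
    Projectivization.mk ℂ w hw ∈ coordLine T l ↔
      l 0 * T w 0 + l 1 * T w 1 + l 2 * T w 2 = 0 := by
  obtain ⟨k, hk⟩ := Projectivization.exists_smul_eq_mk_rep ℂ w hw
  have hk0 : (k : ℂ) ≠ 0 := k.ne_zero
  simp only [coordLine, Set.mem_ofPred_eq, ← hk, Units.smul_def, map_smul, Pi.smul_apply,
    smul_eq_mul]
  constructor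
  · intro h
    exact (mul_eq_zero.mp (by linear_combination h : (k : ℂ) * _ = 0)).resolve_left hk0
  · intro h
    linear_combination (k : ℂ) * h

lemma mk_mem_lineThrough {u v w : Fin 3 → ℂ} (hw : w ≠ 0) :
    Projectivization.mk ℂ w hw ∈ lineThrough u v ↔ w ∈ Submodule.span ℂ {u, v} := by
  rw [Submodule.mem_span_pair]
  constructor
  · rintro ⟨s, t, h, he⟩
    obtain ⟨k, hk⟩ := (Projectivization.mk_eq_mk_iff' ℂ _ _ hw h).mp he
    exact ⟨k * s, k * t, by rw [← hk]; module⟩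
  · rintro ⟨s, t, rfl⟩
    exact ⟨s, t, hw, rfl⟩

lemma ext_mk {S S' : Set P2}
    (h : ∀ w hw, Projectivization.mk ℂ w hw ∈ S ↔ Projectivization.mk ℂ w hw ∈ S') : S = S' := by
  ext p
  simpa using h p.rep p.rep_nonzero

/-- The linear form on `ℂ³` with coefficients `l` in the linear coordinates `T`. -/
def coordForm (T : (Fin 3 → ℂ) ≃ₗ[ℂ] (Fin 3 → ℂ)) (l : Fin 3 → ℂ) :
    Module.Dual ℂ (Fin 3 → ℂ) :=
  (∑ i, l i • LinearMap.proj i) ∘ₗ T.toLinearMap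

lemma coordForm_apply (T : (Fin 3 → ℂ) ≃ₗ[ℂ] (Fin 3 → ℂ)) (l w : Fin 3 → ℂ) :
    coordForm T l w = l 0 * T w 0 + l 1 * T w 1 + l 2 * T w 2 := by
  simp [coordForm, Fin.sum_univ_three]

lemma coordForm_ne_zero (T : (Fin 3 → ℂ) ≃ₗ[ℂ] (Fin 3 → ℂ)) {l : Fin 3 → ℂ} (hl : l ≠ 0) :
    coordForm T l ≠ 0 := by
  intro h
  apply hl
  ext i
  have := LinearMap.congr_fun h (T.symm (Pi.single i 1))
  rw [coordForm_apply] at this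
  fin_cases i <;> simpa using this

lemma exists_coordForm_eq (T : (Fin 3 → ℂ) ≃ₗ[ℂ] (Fin 3 → ℂ)) (f : Module.Dual ℂ (Fin 3 → ℂ)) :
    ∃ l, coordForm T l = f := by
  refine ⟨fun i => f (T.symm (Pi.single i 1)), ?_⟩
  refine LinearMap.ext fun w => ?_
  obtain ⟨x, rfl⟩ := T.symm.surjective w
  have hx : x = x 0 • Pi.single 0 1 + x 1 • Pi.single 1 1 + x 2 • Pi.single 2 1 := by
    ext i
    fin_cases i <;> simp
  conv_rhs => rw [hx]
  simp [coordForm_apply]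
  ring

lemma mem_coordLine_iff_ker {T : (Fin 3 → ℂ) ≃ₗ[ℂ] (Fin 3 → ℂ)} {l w : Fin 3 → ℂ} (hw : w ≠ 0) :
    Projectivization.mk ℂ w hw ∈ coordLine T l ↔ w ∈ (coordForm T l).ker := by
  rw [mk_mem_coordLine, LinearMap.mem_ker, coordForm_apply]

lemma finrank_ker_dual {f : Module.Dual ℂ (Fin 3 → ℂ)} (hf : f ≠ 0) :
    Module.finrank ℂ f.ker = 2 := by
  have := Module.Dual.finrank_ker_add_one_of_ne_zero hf
  simp at this
  omega

lemma isLine_iff (T : (Fin 3 → ℂ) ≃ₗ[ℂ] (Fin 3 → ℂ)) (S : Set P2) :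
    IsLine S ↔ ∃ l, l ≠ 0 ∧ S = coordLine T l := by
  constructor
  · rintro ⟨u, v, huv, rfl⟩
    have hrank : Module.finrank ℂ (Submodule.span ℂ {u, v}) = 2 := by
      have := finrank_span_eq_card huv
      rwa [Matrix.range_cons_cons_empty, Fintype.card_fin] at this
    have hlt : Submodule.span ℂ {u, v} < ⊤ := by
      rw [lt_top_iff_ne_top]
      intro h
      rw [h, finrank_top] at hrank
      simp at hrank
    obtain ⟨f, hf, hle⟩ := Submodule.exists_le_ker_of_lt_top _ hlt
    obtain ⟨l, rfl⟩ := exists_coordForm_eq T f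
    have heq := Submodule.eq_of_le_of_finrank_eq hle (by rw [hrank, finrank_ker_dual hf])
    refine ⟨l, ?_, ext_mk fun w hw => by rw [mk_mem_lineThrough, mem_coordLine_iff_ker, heq]⟩
    rintro rfl
    exact hf (by simp [coordForm])
  · rintro ⟨l, hl, rfl⟩
    let e := Module.finBasisOfFinrankEq ℂ _ (finrank_ker_dual (coordForm_ne_zero T hl))
    have hli : LinearIndependent ℂ ![(e 0 : Fin 3 → ℂ), e 1] := by
      rw [LinearIndependent.pair_iff]
      intro s t h
      refine LinearIndependent.pair_iff.mp (?_ : LinearIndependent ℂ ![e 0, e 1]) s t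
        (Subtype.ext (by simpa using h))
      convert e.linearIndependent using 1
      ext i
      fin_cases i <;> rfl
    refine ⟨e 0, e 1, hli, ext_mk fun w hw => ?_⟩
    rw [mk_mem_lineThrough, mem_coordLine_iff_ker, Submodule.mem_span_pair]
    constructor
    · intro h
      refine ⟨e.repr ⟨w, h⟩ 0, e.repr ⟨w, h⟩ 1, ?_⟩
      have := congrArg Subtype.val (e.sum_repr ⟨w, h⟩)
      rwa [Fin.sum_univ_two] at this
    · rintro ⟨s, t, rfl⟩
      exact Submodule.add_mem _ (Submodule.smul_mem _ _ (e 0).2) (Submodule.smul_mem _ _ (e 1).2)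

/-- Equal lines have proportional coefficients. -/
lemma mul_eq_mul_of_coordLine_eq {T : (Fin 3 → ℂ) ≃ₗ[ℂ] (Fin 3 → ℂ)} {l m : Fin 3 → ℂ}
    (h : coordLine T l = coordLine T m) : l 0 * m 1 = m 0 * l 1 ∧ l 0 * m 2 = m 0 * l 2 := by
  have key : ∀ y : Fin 3 → ℂ, l 0 * y 0 + l 1 * y 1 + l 2 * y 2 = 0 →
      m 0 * y 0 + m 1 * y 1 + m 2 * y 2 = 0 := by
    intro y hy
    by_cases hy0 : y = 0
    · simp [hy0]
    have hw : T.symm y ≠ 0 := by simpa using hy0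
    have := (mk_mem_coordLine (T := T) (l := l) hw).mpr (by simpa using hy)
    rw [h, mk_mem_coordLine] at this
    simpa using this
  have h1 := key ![l 1, -l 0, 0] (by simp; ring)
  have h2 := key ![l 2, 0, -l 0] (by simp; ring)
  simp at h1 h2
  exact ⟨by linear_combination -h1, by linear_combination -h2⟩

lemma coordLine_smul (T : (Fin 3 → ℂ) ≃ₗ[ℂ] (Fin 3 → ℂ)) {k : ℂ} (hk : k ≠ 0) (l : Fin 3 → ℂ) :
    coordLine T (k • l) = coordLine T l := by
  ext p
  simp only [coordLine, Set.mem_ofPred_eq, Pi.smul_apply, smul_eq_mul, mul_assoc, ← mul_add,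
    mul_eq_zero, hk, false_or]

/-- On a line `X x + Y y + Z z = 0` and a conic `α x² + β y² + γ z² = 0`, the failure of
`(X, Y, Z)` to be the polar line of `(x, y, z)` is measured by the dual conic at `(X, Y, Z)`. -/
lemma sq_polar_sub_eq {α β γ x y z X Y Z : ℂ} (hl : X * x + Y * y + Z * z = 0)
    (hq : α * x ^ 2 + β * y ^ 2 + γ * z ^ 2 = 0) :
    (β * y * Z - γ * z * Y) ^ 2 =
      -x ^ 2 * (β * γ * X ^ 2 + α * γ * Y ^ 2 + α * β * Z ^ 2) := by
  linear_combination (β * Z ^ 2 + γ * Y ^ 2) * hq -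
    β * γ * (X * x + Y * y + Z * z - 2 * X * x) * hl

/-- A line is tangent to a diagonal conic if and only if its coefficients lie on the dual conic. -/
lemma existsUnique_mem_curve_inter_coordLine_iff {F : MvPolynomial (Fin 3) ℂ}
    (hF : F.IsHomogeneous 2) {T : (Fin 3 → ℂ) ≃ₗ[ℂ] (Fin 3 → ℂ)} {a l : Fin 3 → ℂ}
    (hdiag : ∀ w, eval w F = a 0 * T w 0 ^ 2 + a 1 * T w 1 ^ 2 + a 2 * T w 2 ^ 2)
    (ha : ∀ i, a i ≠ 0) (hl : l ≠ 0) :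
    (∃! p : P2, p ∈ curve F ∩ coordLine T l) ↔
      a 1 * a 2 * l 0 ^ 2 + a 0 * a 2 * l 1 ^ 2 + a 0 * a 1 * l 2 ^ 2 = 0 := by
  have ha0 := ha 0
  have ha1 := ha 1
  have ha2 := ha 2
  have hmem : ∀ y (hy : T.symm y ≠ 0),
      Projectivization.mk ℂ (T.symm y) hy ∈ curve F ∩ coordLine T l ↔
      a 0 * y 0 ^ 2 + a 1 * y 1 ^ 2 + a 2 * y 2 ^ 2 = 0 ∧
        l 0 * y 0 + l 1 * y 1 + l 2 * y 2 = 0 := by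
    intro y hy
    rw [Set.mem_inter_iff, mk_mem_curve hF, mk_mem_coordLine, hdiag, T.apply_symm_apply]
  have hrep : ∀ p : P2, ∃ x, ∃ hx : T.symm x ≠ 0, p = Projectivization.mk ℂ (T.symm x) hx :=
    fun p => ⟨T p.rep, by simpa using p.rep_nonzero, by simp⟩
  constructor
  · rintro ⟨p, hp, huniq⟩
    obtain ⟨x, hx, rfl⟩ := hrep p
    obtain ⟨hq, hlx⟩ := (hmem x hx).mp hp
    have hpolar : ∀ y : Fin 3 → ℂ, l 0 * y 0 + l 1 * y 1 + l 2 * y 2 = 0 →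
        a 0 * x 0 * y 0 + a 1 * x 1 * y 1 + a 2 * x 2 * y 2 = 0 := by
      intro y hly
      set b := a 0 * x 0 * y 0 + a 1 * x 1 * y 1 + a 2 * x 2 * y 2 with hb
      set q := a 0 * y 0 ^ 2 + a 1 * y 1 ^ 2 + a 2 * y 2 ^ 2 with hqy
      obtain ⟨k, hk⟩ : ∃ k : ℂ, k • x = q • x - (2 * b) • y := by
        by_cases h0 : q • x - (2 * b) • y = 0
        · exact ⟨0, by rw [h0, zero_smul]⟩
        have h0' : T.symm (q • x - (2 * b) • y) ≠ 0 := T.symm.map_ne_zero_iff.mpr h0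
        have := huniq _ ((hmem _ h0').mpr ⟨by
          simp only [Pi.sub_apply, Pi.smul_apply, smul_eq_mul]
          linear_combination q ^ 2 * hq - 4 * b ^ 2 * hqy + 4 * b * q * hb, by
          simp only [Pi.sub_apply, Pi.smul_apply, smul_eq_mul]
          linear_combination q * hlx - 2 * b * hly⟩)
        obtain ⟨k, hk⟩ := (Projectivization.mk_eq_mk_iff' ℂ _ _ _ _).mp this
        exact ⟨k, T.symm.injective (by rw [map_smul, hk])⟩
      have hk0 := congrFun hk 0
      have hk1 := congrFun hk 1
      have hk2 := congrFun hk 2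
      simp only [Pi.sub_apply, Pi.smul_apply, smul_eq_mul] at hk0 hk1 hk2
      have : b ^ 2 = 0 := by
        linear_combination (q - k) / 2 * hq + a 0 * x 0 / 2 * hk0 + a 1 * x 1 / 2 * hk1 +
          a 2 * x 2 / 2 * hk2 + b * hb
      exact pow_eq_zero_iff two_ne_zero |>.mp this
    have h0 := hpolar ![0, l 2, -l 1] (by simp; ring)
    have h1 := hpolar ![-l 2, 0, l 0] (by simp; ring)
    have h2 := hpolar ![l 1, -l 0, 0] (by simp; ring)
    simp at h0 h1 h2
    set d := a 1 * a 2 * l 0 ^ 2 + a 0 * a 2 * l 1 ^ 2 + a 0 * a 1 * l 2 ^ 2 with hd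
    by_contra hd0
    have e0 := sq_polar_sub_eq hlx hq
    have e1 := sq_polar_sub_eq (α := a 1) (β := a 2) (γ := a 0) (x := x 1) (y := x 2) (z := x 0)
      (X := l 1) (Y := l 2) (Z := l 0) (by linear_combination hlx) (by linear_combination hq)
    have e2 := sq_polar_sub_eq (α := a 2) (β := a 0) (γ := a 1) (x := x 2) (y := x 0) (z := x 1)
      (X := l 2) (Y := l 0) (Z := l 1) (by linear_combination hlx) (by linear_combination hq)
    have hx0 : x 0 = 0 := by grind
    have hx1 : x 1 = 0 := by grind
    have hx2 : x 2 = 0 := by grind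
    apply hx
    have : x = 0 := by ext i; fin_cases i <;> assumption
    rw [this, map_zero]
  · intro hd
    set n : Fin 3 → ℂ := ![a 1 * a 2 * l 0, a 0 * a 2 * l 1, a 0 * a 1 * l 2] with hn
    have hn0 : T.symm n ≠ 0 := by
      intro h
      have h' : n = 0 := by simpa using h
      apply hl
      have h0 := congrFun h' 0
      have h1 := congrFun h' 1
      have h2 := congrFun h' 2
      simp [hn, ha0, ha1, ha2] at h0 h1 h2
      ext i
      fin_cases i <;> assumption
    refine ⟨Projectivization.mk ℂ (T.symm n) hn0, (hmem _ _).mpr ⟨?_, ?_⟩, ?_⟩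
    · simp [hn]
      linear_combination a 0 * a 1 * a 2 * hd
    · simp [hn]
      linear_combination hd
    · intro p hp
      obtain ⟨x, hx, rfl⟩ := hrep p
      obtain ⟨hq, hlx⟩ := (hmem x hx).mp hp
      have e0 := sq_polar_sub_eq hlx hq
      have e1 := sq_polar_sub_eq (α := a 1) (β := a 2) (γ := a 0) (x := x 1) (y := x 2) (z := x 0)
        (X := l 1) (Y := l 2) (Z := l 0) (by linear_combination hlx) (by linear_combination hq)
      have e2 := sq_polar_sub_eq (α := a 2) (β := a 0) (γ := a 1) (x := x 2) (y := x 0) (z := x 1)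
        (X := l 2) (Y := l 0) (Z := l 1) (by linear_combination hlx) (by linear_combination hq)
      have c0 : a 1 * x 1 * l 2 - a 2 * x 2 * l 1 = 0 := by grind
      have c1 : a 2 * x 2 * l 0 - a 0 * x 0 * l 2 = 0 := by grind
      have c2 : a 0 * x 0 * l 1 - a 1 * x 1 * l 0 = 0 := by grind
      obtain ⟨i, hi⟩ := Function.ne_iff.mp hl
      refine (Projectivization.mk_eq_mk_iff' ℂ _ _ _ _).mpr
        ⟨a i * x i / (l i * (a 0 * a 1 * a 2)), ?_⟩
      rw [← map_smul]
      congr 1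
      have hi' : l i ≠ 0 := hi
      ext j
      fin_cases i <;> fin_cases j <;> simp [hn] at hi' ⊢ <;> field_simp <;> grind

lemma exists_ne_zero_sq_eq {x : ℂ} (hx : x ≠ 0) : ∃ y, y ≠ 0 ∧ y ^ 2 = x := by
  obtain ⟨y, hy⟩ := IsAlgClosed.exists_pow_nat_eq x two_pos
  refine ⟨y, ?_, hy⟩
  rintro rfl
  exact hx (by rw [← hy]; simp)

/-- Two diagonal conics whose common points avoid a coordinate line are not proportional. -/
lemma mul_sub_mul_ne_zero_of_common_points {Q R : MvPolynomial (Fin 3) ℂ}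
    (hQ2 : Q.IsHomogeneous 2) (hR2 : R.IsHomogeneous 2)
    {T : (Fin 3 → ℂ) ≃ₗ[ℂ] (Fin 3 → ℂ)} {a b : Fin 3 → ℂ}
    (hQ : ∀ w, eval w Q = a 0 * T w 0 ^ 2 + a 1 * T w 1 ^ 2 + a 2 * T w 2 ^ 2)
    (hR : ∀ w, eval w R = b 0 * T w 0 ^ 2 + b 1 * T w 1 ^ 2 + b 2 * T w 2 ^ 2)
    (ha : a 1 ≠ 0) (hne : ∀ p ∈ curve Q ∩ curve R, T p.rep 0 ≠ 0) :
    a 1 * b 2 - a 2 * b 1 ≠ 0 := by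
  intro h
  obtain ⟨y, hy⟩ := IsAlgClosed.exists_pow_nat_eq (-a 2) two_pos
  obtain ⟨z, hz0, hz⟩ := exists_ne_zero_sq_eq ha
  have hw : T.symm ![0, y, z] ≠ 0 := T.symm.map_ne_zero_iff.mpr fun h0 => hz0 (congrFun h0 2)
  obtain ⟨k, hk⟩ := Projectivization.exists_smul_eq_mk_rep ℂ _ hw
  refine hne (Projectivization.mk ℂ _ hw) ⟨(mk_mem_curve hQ2 hw).mpr ?_,
    (mk_mem_curve hR2 hw).mpr ?_⟩ ?_
  · rw [hQ, T.apply_symm_apply]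
    simp [hy, hz]
    ring
  · rw [hR, T.apply_symm_apply]
    simp [hy, hz]
    linear_combination h
  · rw [← hk, Units.smul_def, map_smul, T.apply_symm_apply]
    simp

/-- The simultaneous solutions of the equations of two dual diagonal conics. -/
lemma dual_conics_iff {a b : Fin 3 → ℂ} (hsa : a 0 + a 1 + a 2 = 0) (hsb : b 0 + b 1 + b 2 = 0)
    (ha : ∀ i, a i ≠ 0) (hb : ∀ i, b i ≠ 0) (hab : a 1 * b 2 - a 2 * b 1 ≠ 0) (l : Fin 3 → ℂ) :
    (a 1 * a 2 * l 0 ^ 2 + a 0 * a 2 * l 1 ^ 2 + a 0 * a 1 * l 2 ^ 2 = 0 ∧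
      b 1 * b 2 * l 0 ^ 2 + b 0 * b 2 * l 1 ^ 2 + b 0 * b 1 * l 2 ^ 2 = 0) ↔
    (a 1 * b 1 * l 0 ^ 2 = a 0 * b 0 * l 1 ^ 2 ∧ a 2 * b 2 * l 0 ^ 2 = a 0 * b 0 * l 2 ^ 2) := by
  constructor
  · rintro ⟨h1, h2⟩
    constructor
    · apply mul_left_cancel₀ hab
      linear_combination b 0 * b 1 * h1 - a 0 * a 1 * h2 -
        a 1 * b 1 * l 0 ^ 2 * (a 2 * hsb - b 2 * hsa)
    · apply mul_left_cancel₀ hab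
      linear_combination -b 0 * b 2 * h1 + a 0 * a 2 * h2 +
        a 2 * b 2 * l 0 ^ 2 * (a 1 * hsb - b 1 * hsa)
  · rintro ⟨h1, h2⟩
    have h0 : a 0 * b 0 ≠ 0 := mul_ne_zero (ha 0) (hb 0)
    constructor
    · apply mul_left_cancel₀ h0
      linear_combination -a 0 * a 2 * h1 - a 0 * a 1 * h2 + a 0 * a 1 * a 2 * l 0 ^ 2 * hsb
    · apply mul_left_cancel₀ h0
      linear_combination -b 0 * b 2 * h1 - b 0 * b 1 * h2 + b 0 * b 1 * b 2 * l 0 ^ 2 * hsa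

/-- Two smooth conics in `ℙ²` intersecting transversally in four
distinct points have exactly four distinct common tangent lines. -/
theorem transversal_conics_four_common_tangents
    (Q R : MvPolynomial (Fin 3) ℂ)
    (hQ0 : Q ≠ 0) (hQ2 : Q.IsHomogeneous 2) (hQsm : SmoothCurve Q)
    (hR0 : R ≠ 0) (hR2 : R.IsHomogeneous 2) (hRsm : SmoothCurve R)
    (hmeet : (curve Q ∩ curve R).ncard = 4)
    (htrans : ∀ p ∈ curve Q ∩ curve R, ∀ S S' : Set P2,
      TangentAt Q S p → TangentAt R S' p → S ≠ S') :
    {S : Set P2 | IsLine S ∧ (∃! p : P2, p ∈ curve Q ∩ S) ∧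
      (∃! p : P2, p ∈ curve R ∩ S)}.ncard = 4 := by
  obtain ⟨T, a, b, hQ, hR, hsa, hsb, ha, hb, hne⟩ :=
    exists_simultaneous_diagonalization hQ2 hQsm hR2 hRsm hmeet
  have hab := mul_sub_mul_ne_zero_of_common_points hQ2 hR2 hQ hR (ha 1) hne
  have hroot : ∀ i, ∃ y : ℂ, y ≠ 0 ∧ y ^ 2 = a i * b i := fun i =>
    exists_ne_zero_sq_eq (mul_ne_zero (ha i) (hb i))
  choose r hr0 hr using hroot
  let s : ℤˣ × ℤˣ → Set P2 := fun ε =>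
    coordLine T ![r 0, ((ε.1 : ℤ) : ℂ) * r 1, ((ε.2 : ℤ) : ℂ) * r 2]
  have hs : Function.Injective s := by
    intro ε δ h
    obtain ⟨h1, h2⟩ := mul_eq_mul_of_coordLine_eq h
    simp [hr0] at h1 h2
    exact Prod.ext (Units.ext h1.symm) (Units.ext h2.symm)
  have hrange : {S : Set P2 | IsLine S ∧ (∃! p : P2, p ∈ curve Q ∩ S) ∧
      (∃! p : P2, p ∈ curve R ∩ S)} = Set.range s := by
    ext S
    rw [Set.mem_ofPred_eq, isLine_iff T]
    constructor
    · rintro ⟨⟨l, hl, rfl⟩, hSQ, hSR⟩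
      rw [existsUnique_mem_curve_inter_coordLine_iff hQ2 hQ ha hl] at hSQ
      rw [existsUnique_mem_curve_inter_coordLine_iff hR2 hR hb hl] at hSR
      obtain ⟨h1, h2⟩ := (dual_conics_iff hsa hsb ha hb hab l).mp ⟨hSQ, hSR⟩
      rw [← hr, ← hr, ← mul_pow, ← mul_pow] at h1 h2
      have hl0 : l 0 ≠ 0 := by
        intro h
        apply hl
        ext i
        fin_cases i
        · exact h
        · simpa [h, hr0] using h1.symm
        · simpa [h, hr0] using h2.symm
      have hsign : ∀ i, (r i * l 0) ^ 2 = (r 0 * l i) ^ 2 →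
          ∃ ε : ℤˣ, ((ε : ℤ) : ℂ) * r i = r 0 / l 0 * l i := by
        intro i hi
        rcases sq_eq_sq_iff_eq_or_eq_neg.mp hi with h | h
        · exact ⟨1, by field_simp; push_cast; linear_combination h⟩
        · exact ⟨-1, by field_simp; push_cast; linear_combination -h⟩
      obtain ⟨ε, hε⟩ := hsign 1 h1
      obtain ⟨δ, hδ⟩ := hsign 2 h2
      refine ⟨(ε, δ), ?_⟩
      rw [← coordLine_smul T (div_ne_zero (hr0 0) hl0) l]
      simp only [s, hε, hδ]
      congr 1
      ext i
      fin_cases i <;> simp [hl0]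
    · rintro ⟨⟨ε, δ⟩, rfl⟩
      have hl : ![r 0, ((ε : ℤ) : ℂ) * r 1, ((δ : ℤ) : ℂ) * r 2] ≠ 0 :=
        fun h => hr0 0 (congrFun h 0)
      have hsq : ∀ η : ℤˣ, (((η : ℤ) : ℂ)) ^ 2 = 1 := by
        intro η
        rcases Int.units_eq_one_or η with rfl | rfl <;> simp
      refine ⟨⟨_, hl, rfl⟩, ?_⟩
      simp only [s]
      rw [existsUnique_mem_curve_inter_coordLine_iff hQ2 hQ ha hl,
        existsUnique_mem_curve_inter_coordLine_iff hR2 hR hb hl,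
        dual_conics_iff hsa hsb ha hb hab]
      simp [mul_pow, hsq, hr]
      constructor <;> ring
  rw [hrange, Set.ncard_range_of_injective hs]
  simp

end
end

section
/- Let n₁, n₂, n₃ be three non-collinear points of ℙ²(ℂ), and let X and Y be irreducible plane quartics whose singular loci consist exactly of ordinary nodes at n₁, n₂, n₃ (trinodal quartics with the same nodes). If X and Y have the same set of theta-lines, then X = Y. In particular, an irreducible quartic with exactly three nodes is uniquely determined, among trinodal quartics with the same nodes, by its theta-lines. -/
open MvPolynomial

noncomputable section

theorem eval_lineRest (F : MvPolynomial (Fin 3) ℂ) (a b : Fin 3 → ℂ) (t : ℂ) :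
    (lineRest F a b).eval t = eval (a + t • b) F := by
  unfold lineRest
  rw [← Polynomial.coe_evalRingHom, MvPolynomial.hom_eval₂]
  have h : (Polynomial.evalRingHom t).comp Polynomial.C = RingHom.id ℂ := by
    ext; simp
  rw [h, MvPolynomial.eval₂_id]
  congr 2
  funext i
  simp
  ring

theorem derivative_lineRest (F : MvPolynomial (Fin 3) ℂ) (a b : Fin 3 → ℂ) :
    Polynomial.derivative (lineRest F a b) =
      ∑ i, Polynomial.C (b i) * lineRest (pderiv i F) a b := by
  induction F using MvPolynomial.induction_on with
  | C c => simp [lineRest]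
  | add p q hp hq =>
    simp only [lineRest, map_add, eval₂_add, mul_add, Finset.sum_add_distrib] at hp hq ⊢
    rw [hp, hq]
  | mul_X p i hp =>
    simp only [lineRest, Derivation.leibniz, eval₂_mul, eval₂_X, Polynomial.derivative_mul,
      smul_eq_mul, eval₂_add, pderiv_X, map_add] at hp ⊢
    rw [hp]
    fin_cases i <;> simp [Fin.sum_univ_three, Pi.single_apply] <;> ring

theorem coeff_zero_lineRest (F : MvPolynomial (Fin 3) ℂ) (a b : Fin 3 → ℂ) :
    (lineRest F a b).coeff 0 = eval a F := by
  rw [Polynomial.coeff_zero_eq_eval_zero, eval_lineRest]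
  simp

theorem coeff_one_lineRest (F : MvPolynomial (Fin 3) ℂ) (a b : Fin 3 → ℂ) :
    (lineRest F a b).coeff 1 = ∑ i, b i * eval a (pderiv i F) := by
  have h := congrArg (fun P => Polynomial.coeff P 0) (derivative_lineRest F a b)
  simpa [Polynomial.coeff_derivative, Polynomial.finsetSum_coeff, coeff_zero_lineRest] using h

theorem two_mul_coneCoeff (F : MvPolynomial (Fin 3) ℂ) (a b : Fin 3 → ℂ) :
    2 * coneCoeff F a b = ∑ i, ∑ j, b i * b j * eval a (pderiv j (pderiv i F)) := by
  have h := congrArg (fun P => Polynomial.coeff P 1) (derivative_lineRest F a b)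
  simp only [Polynomial.coeff_derivative, Polynomial.finsetSum_coeff, Polynomial.coeff_C_mul,
    coeff_one_lineRest, Finset.mul_sum, ← mul_assoc] at h
  rw [← h, coneCoeff]
  norm_num
  ring

theorem coeff_of_eval_eq {P : Polynomial ℂ} {k₀ k₁ k₂ k₃ k₄ : ℂ}
    (h : ∀ t, P.eval t = k₀ + k₁ * t + k₂ * t ^ 2 + k₃ * t ^ 3 + k₄ * t ^ 4) :
    P.coeff 0 = k₀ ∧ P.coeff 1 = k₁ ∧ P.coeff 2 = k₂ := by
  have hP : P = Polynomial.C k₀ + Polynomial.C k₁ * Polynomial.X +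
      Polynomial.C k₂ * Polynomial.X ^ 2 + Polynomial.C k₃ * Polynomial.X ^ 3 +
      Polynomial.C k₄ * Polynomial.X ^ 4 :=
    Polynomial.funext fun t => by simp [h]
  subst hP
  refine ⟨?_, ?_, ?_⟩ <;> simp [Polynomial.coeff_X, Polynomial.coeff_C]

theorem eval_smul_of_isHomogeneous_s16 {H : MvPolynomial (Fin 3) ℂ} {n : ℕ} (hH : H.IsHomogeneous n)
    (c : ℂ) (w : Fin 3 → ℂ) : eval (c • w) H = c ^ n * eval w H := by
  rw [MvPolynomial.eval_eq', MvPolynomial.eval_eq', Finset.mul_sum]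
  refine Finset.sum_congr rfl fun d hd => ?_
  have hdeg : ∑ i, d i = n := by
    simpa [Finsupp.weight_apply, Finsupp.sum_fintype] using hH (mem_support_iff.mp hd)
  simp only [Pi.smul_apply, smul_eq_mul, mul_pow, Finset.prod_mul_distrib,
    Finset.prod_pow_eq_pow_sum, hdeg]
  ring

theorem mem_curve_of_eval_eq_zero {F : MvPolynomial (Fin 3) ℂ} {n : ℕ} (hF : F.IsHomogeneous n)
    {w : Fin 3 → ℂ} (hw : w ≠ 0) (h : eval w F = 0) : Projectivization.mk ℂ w hw ∈ curve F := by
  intro v hv hvw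
  obtain ⟨c, rfl⟩ := (Projectivization.mk_eq_mk_iff' ℂ v w hv hw).mp hvw
  rw [eval_smul_of_isHomogeneous_s16 hF, h, mul_zero]

theorem isSingularAt_of_coeff {F : MvPolynomial (Fin 3) ℂ} {n : ℕ} (hF : F.IsHomogeneous n)
    {w : Fin 3 → ℂ} (hw : w ≠ 0)
    (h : ∀ b, (lineRest F w b).coeff 0 = 0 ∧ (lineRest F w b).coeff 1 = 0) :
    IsSingularAt F (Projectivization.mk ℂ w hw) := by
  intro l hl v hv hvw
  obtain ⟨c, rfl⟩ := (Projectivization.mk_eq_mk_iff' ℂ v w hv hw).mp hvw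
  match l, hl with
  | [], _ =>
    have := (h 0).1
    rw [coeff_zero_lineRest] at this
    simp [pderivList, eval_smul_of_isHomogeneous_s16 hF, this]
  | [i], _ =>
    have := (h (Pi.single i 1)).2
    rw [coeff_one_lineRest] at this
    have hi : eval w (pderiv i F) = 0 := by simpa [Pi.single_apply] using this
    simp [pderivList, eval_smul_of_isHomogeneous_s16 hF.pderiv, hi]

theorem coeff_of_isSingularAt {F : MvPolynomial (Fin 3) ℂ} {w : Fin 3 → ℂ} (hw : w ≠ 0)
    (h : IsSingularAt F (Projectivization.mk ℂ w hw)) (b : Fin 3 → ℂ) :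
    (lineRest F w b).coeff 0 = 0 ∧ (lineRest F w b).coeff 1 = 0 := by
  rw [coeff_zero_lineRest, coeff_one_lineRest]
  refine ⟨h [] (by simp) w hw rfl, Finset.sum_eq_zero fun i _ => ?_⟩
  rw [show eval w (pderiv i F) = 0 from h [i] (by simp) w hw rfl, mul_zero]

theorem pderiv_comm (F : MvPolynomial (Fin 3) ℂ) (i j : Fin 3) :
    pderiv i (pderiv j F) = pderiv j (pderiv i F) := by
  have h : ⁅pderiv (R := ℂ) i, pderiv j⁆ = 0 := MvPolynomial.derivation_ext fun k => by
    rw [Derivation.commutator_apply]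
    by_cases hi : i = k <;> by_cases hj : j = k <;> simp [pderiv_X, hi, hj]
  have := DFunLike.congr_fun h F
  rwa [Derivation.commutator_apply, Derivation.zero_apply, sub_eq_zero] at this

theorem vanishesToOrder_three_of_coneCoeff {F : MvPolynomial (Fin 3) ℂ} {n : ℕ}
    (hF : F.IsHomogeneous n) {w : Fin 3 → ℂ} (hw : w ≠ 0)
    (hs : IsSingularAt F (Projectivization.mk ℂ w hw)) (h : ∀ b, coneCoeff F w b = 0) :
    VanishesToOrder F (Projectivization.mk ℂ w hw) 3 := by
  intro l hl v hv hvw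
  have key : ∀ i j, eval w (pderiv j (pderiv i F)) = 0 := by
    have hQ : ∀ b : Fin 3 → ℂ, ∑ i, ∑ j, b i * b j * eval w (pderiv j (pderiv i F)) = 0 :=
      fun b => by rw [← two_mul_coneCoeff, h, mul_zero]
    have h0 := hQ ![1, 0, 0]
    have h1 := hQ ![0, 1, 0]
    have h2 := hQ ![0, 0, 1]
    have h01 := hQ ![1, 1, 0]
    have h02 := hQ ![1, 0, 1]
    have h12 := hQ ![0, 1, 1]
    have c01 := congrArg (eval w) (pderiv_comm F 0 1)
    have c02 := congrArg (eval w) (pderiv_comm F 0 2)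
    have c12 := congrArg (eval w) (pderiv_comm F 1 2)
    simp [Fin.sum_univ_three] at h0 h1 h2 h01 h02 h12 c01 c02 c12
    intro i j
    fin_cases i <;> fin_cases j <;> simp <;> grind
  match l, hl with
  | [], _ => exact hs [] (by simp) v hv hvw
  | [i], _ => exact hs [i] (by simp) v hv hvw
  | [i, j], _ =>
    obtain ⟨c, rfl⟩ := (Projectivization.mk_eq_mk_iff' ℂ v w hv hw).mp hvw
    simp [pderivList, eval_smul_of_isHomogeneous_s16 hF.pderiv.pderiv, key]

/-- In the coordinates given by the frame `p, q, r`, the form `F` is the quartic obtained from the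
conic with matrix `!![a, f, e; f, b, d; e, d, c]` by the standard quadratic transformation. -/
def IsTrinodalForm (F : MvPolynomial (Fin 3) ℂ) (p q r : Fin 3 → ℂ) (a b c d e f : ℂ) : Prop :=
  ∀ x y z : ℂ, eval (x • p + y • q + z • r) F =
    a * y ^ 2 * z ^ 2 + b * x ^ 2 * z ^ 2 + c * x ^ 2 * y ^ 2
      + 2 * x * y * z * (d * x + e * y + f * z)

theorem IsTrinodalForm.rotate {F : MvPolynomial (Fin 3) ℂ} {p q r : Fin 3 → ℂ}
    {a b c d e f : ℂ} (h : IsTrinodalForm F p q r a b c d e f) :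
    IsTrinodalForm F q r p b c a e f d := by
  intro x y z
  rw [show x • q + y • r + z • p = z • p + x • q + y • r by abel, h]
  ring

theorem exists_quartic_coeffs {F : MvPolynomial (Fin 3) ℂ} (hF : F.IsHomogeneous 4) :
    ∃ k : ℕ → ℕ → ℂ, ∀ x y z : ℂ, eval ![x, y, z] F =
      ∑ i ∈ Finset.range 5, ∑ j ∈ Finset.range (5 - i),
        k i j * (x ^ (4 - i - j) * y ^ i * z ^ j) := by
  refine ⟨fun i j => ∑ d ∈ F.support, if i = d 1 ∧ j = d 2 then coeff d F else 0, ?_⟩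
  intro x y z
  rw [MvPolynomial.eval_eq']
  simp only [Finset.sum_mul]
  have hswap : ∀ i, (∑ j ∈ Finset.range (5 - i), ∑ d ∈ F.support,
      (if i = d 1 ∧ j = d 2 then coeff d F else 0) * (x ^ (4 - i - j) * y ^ i * z ^ j)) =
      ∑ d ∈ F.support, ∑ j ∈ Finset.range (5 - i),
      (if i = d 1 ∧ j = d 2 then coeff d F else 0) * (x ^ (4 - i - j) * y ^ i * z ^ j) :=
    fun i => Finset.sum_comm
  simp only [hswap]
  rw [Finset.sum_comm]
  refine Finset.sum_congr rfl fun d hd => ?_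
  have hdeg : d 0 + d 1 + d 2 = 4 := by
    simpa [Finsupp.weight_apply, Finsupp.sum_fintype, Fin.sum_univ_three] using
      hF (mem_support_iff.mp hd)
  rw [Finset.sum_eq_single (d 1), Finset.sum_eq_single (d 2)]
  · rw [show 4 - d 1 - d 2 = d 0 by omega]
    simp [Fin.prod_univ_three]
  · intro j _ hj
    simp [hj]
  · intro hj
    simp at hj
    omega
  · intro i _ hi
    simp [hi]
  · intro hi
    simp at hi
    omega

theorem exists_quartic_coeffs_frame {F : MvPolynomial (Fin 3) ℂ} (hF : F.IsHomogeneous 4)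
    (p q r : Fin 3 → ℂ) :
    ∃ k : ℕ → ℕ → ℂ, ∀ x y z : ℂ, eval (x • p + y • q + z • r) F =
      ∑ i ∈ Finset.range 5, ∑ j ∈ Finset.range (5 - i),
        k i j * (x ^ (4 - i - j) * y ^ i * z ^ j) := by
  have hlin : ∀ i, (C (p i) * X 0 + C (q i) * X 1 + C (r i) * X 2 :
      MvPolynomial (Fin 3) ℂ).IsHomogeneous 1 := fun i =>
    ((isHomogeneous_C_mul_X _ _).add (isHomogeneous_C_mul_X _ _)).add (isHomogeneous_C_mul_X _ _)
  obtain ⟨k, hk⟩ := exists_quartic_coeffs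
    (F := aeval (fun i => C (p i) * X 0 + C (q i) * X 1 + C (r i) * X 2) F)
    (by simpa using hF.aeval _ hlin)
  refine ⟨k, fun x y z => ?_⟩
  rw [← hk, ← MvPolynomial.coe_aeval_eq_eval ![x, y, z], RingHom.coe_coe,
    ← AlgHom.comp_apply, MvPolynomial.comp_aeval, MvPolynomial.aeval_eq_eval]
  have hv : x • p + y • q + z • r = fun i =>
      aeval ![x, y, z] (C (p i) * X 0 + C (q i) * X 1 + C (r i) * X 2) := by
    funext i
    simp
    ring
  rw [hv]

theorem exists_isTrinodalForm {F : MvPolynomial (Fin 3) ℂ} (hF : F.IsHomogeneous 4)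
    {p q r : Fin 3 → ℂ} (hp : p ≠ 0) (hq : q ≠ 0) (hr : r ≠ 0)
    (hsp : IsSingularAt F (Projectivization.mk ℂ p hp))
    (hsq : IsSingularAt F (Projectivization.mk ℂ q hq))
    (hsr : IsSingularAt F (Projectivization.mk ℂ r hr)) :
    ∃ a b c d e f, IsTrinodalForm F p q r a b c d e f := by
  obtain ⟨k, hk⟩ := exists_quartic_coeffs_frame hF p q r
  simp [Finset.sum_range_succ] at hk
  have hpq := coeff_of_eval_eq (P := lineRest F p q) (k₀ := k 0 0) (k₁ := k 1 0) (k₂ := k 2 0)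
    (k₃ := k 3 0) (k₄ := k 4 0) fun t => by
      rw [eval_lineRest, show p + t • q = (1 : ℂ) • p + t • q + (0 : ℂ) • r by simp, hk]; ring
  have hpr := coeff_of_eval_eq (P := lineRest F p r) (k₀ := k 0 0) (k₁ := k 0 1) (k₂ := k 0 2)
    (k₃ := k 0 3) (k₄ := k 0 4) fun t => by
      rw [eval_lineRest, show p + t • r = (1 : ℂ) • p + (0 : ℂ) • q + t • r by simp, hk]; ring
  have hqp := coeff_of_eval_eq (P := lineRest F q p) (k₀ := k 4 0) (k₁ := k 3 0) (k₂ := k 2 0)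
    (k₃ := k 1 0) (k₄ := k 0 0) fun t => by
      rw [eval_lineRest, show q + t • p = t • p + (1 : ℂ) • q + (0 : ℂ) • r by simp [add_comm],
        hk]; ring
  have hqr := coeff_of_eval_eq (P := lineRest F q r) (k₀ := k 4 0) (k₁ := k 3 1) (k₂ := k 2 2)
    (k₃ := k 1 3) (k₄ := k 0 4) fun t => by
      rw [eval_lineRest, show q + t • r = (0 : ℂ) • p + (1 : ℂ) • q + t • r by simp, hk]; ring
  have hrp := coeff_of_eval_eq (P := lineRest F r p) (k₀ := k 0 4) (k₁ := k 0 3) (k₂ := k 0 2)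
    (k₃ := k 0 1) (k₄ := k 0 0) fun t => by
      rw [eval_lineRest, show r + t • p = t • p + (0 : ℂ) • q + (1 : ℂ) • r by simp [add_comm],
        hk]; ring
  have hrq := coeff_of_eval_eq (P := lineRest F r q) (k₀ := k 0 4) (k₁ := k 1 3) (k₂ := k 2 2)
    (k₃ := k 3 1) (k₄ := k 4 0) fun t => by
      rw [eval_lineRest, show r + t • q = (0 : ℂ) • p + t • q + (1 : ℂ) • r by simp [add_comm],
        hk]; ring
  have e00 := hpq.1.symm.trans (coeff_of_isSingularAt hp hsp q).1
  have e10 := hpq.2.1.symm.trans (coeff_of_isSingularAt hp hsp q).2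
  have e01 := hpr.2.1.symm.trans (coeff_of_isSingularAt hp hsp r).2
  have e40 := hqp.1.symm.trans (coeff_of_isSingularAt hq hsq p).1
  have e30 := hqp.2.1.symm.trans (coeff_of_isSingularAt hq hsq p).2
  have e31 := hqr.2.1.symm.trans (coeff_of_isSingularAt hq hsq r).2
  have e04 := hrp.1.symm.trans (coeff_of_isSingularAt hr hsr p).1
  have e03 := hrp.2.1.symm.trans (coeff_of_isSingularAt hr hsr p).2
  have e13 := hrq.2.1.symm.trans (coeff_of_isSingularAt hr hsr q).2
  refine ⟨k 2 2, k 0 2, k 2 0, k 1 1 / 2, k 2 1 / 2, k 1 2 / 2, fun x y z => ?_⟩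
  rw [hk, e00, e10, e01, e40, e30, e31, e04, e03, e13]
  ring

theorem IsTrinodalForm.lineRest_coeff {F : MvPolynomial (Fin 3) ℂ} {p q r : Fin 3 → ℂ}
    {a b c d e f : ℂ} (h : IsTrinodalForm F p q r a b c d e f) (x y z x' y' z' : ℂ) :
    (lineRest F (x • p + y • q + z • r) (x' • p + y' • q + z' • r)).coeff 0 =
      a * y ^ 2 * z ^ 2 + b * x ^ 2 * z ^ 2 + c * x ^ 2 * y ^ 2
        + 2 * x * y * z * (d * x + e * y + f * z) ∧
    (lineRest F (x • p + y • q + z • r) (x' • p + y' • q + z' • r)).coeff 1 =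
      x' * (2 * b * x * z ^ 2 + 2 * c * x * y ^ 2
        + 2 * y * z * (2 * d * x + e * y + f * z)) +
      y' * (2 * a * y * z ^ 2 + 2 * c * x ^ 2 * y
        + 2 * x * z * (d * x + 2 * e * y + f * z)) +
      z' * (2 * a * y ^ 2 * z + 2 * b * x ^ 2 * z
        + 2 * x * y * (d * x + e * y + 2 * f * z)) := by
  obtain ⟨h0, h1, -⟩ := coeff_of_eval_eq
    (P := lineRest F (x • p + y • q + z • r) (x' • p + y' • q + z' • r))
    (k₀ := a * y ^ 2 * z ^ 2 + b * x ^ 2 * z ^ 2 + c * x ^ 2 * y ^ 2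
        + 2 * x * y * z * (d * x + e * y + f * z))
    (k₁ := x' * (2 * b * x * z ^ 2 + 2 * c * x * y ^ 2
        + 2 * y * z * (2 * d * x + e * y + f * z)) +
      y' * (2 * a * y * z ^ 2 + 2 * c * x ^ 2 * y
        + 2 * x * z * (d * x + 2 * e * y + f * z)) +
      z' * (2 * a * y ^ 2 * z + 2 * b * x ^ 2 * z
        + 2 * x * y * (d * x + e * y + 2 * f * z)))
    (k₂ := a * (y' ^ 2 * z ^ 2 + 4 * y * y' * z * z' + y ^ 2 * z' ^ 2)
        + b * (x' ^ 2 * z ^ 2 + 4 * x * x' * z * z' + x ^ 2 * z' ^ 2)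
        + c * (x' ^ 2 * y ^ 2 + 4 * x * x' * y * y' + x ^ 2 * y' ^ 2)
        + 2 * d * (x' ^ 2 * y * z + 2 * x * x' * (y' * z + y * z') + x ^ 2 * y' * z')
        + 2 * e * (y' ^ 2 * x * z + 2 * y * y' * (x' * z + x * z') + y ^ 2 * x' * z')
        + 2 * f * (z' ^ 2 * x * y + 2 * z * z' * (x' * y + x * y') + z ^ 2 * x' * y'))
    (k₃ := x * (2 * b * x' * z' ^ 2 + 2 * c * x' * y' ^ 2
        + 2 * y' * z' * (2 * d * x' + e * y' + f * z')) +
      y * (2 * a * y' * z' ^ 2 + 2 * c * x' ^ 2 * y'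
        + 2 * x' * z' * (d * x' + 2 * e * y' + f * z')) +
      z * (2 * a * y' ^ 2 * z' + 2 * b * x' ^ 2 * z'
        + 2 * x' * y' * (d * x' + e * y' + 2 * f * z')))
    (k₄ := a * y' ^ 2 * z' ^ 2 + b * x' ^ 2 * z' ^ 2 + c * x' ^ 2 * y' ^ 2
        + 2 * x' * y' * z' * (d * x' + e * y' + f * z')) fun t => by
      rw [eval_lineRest, show x • p + y • q + z • r + t • (x' • p + y' • q + z' • r) =
        (x + t * x') • p + (y + t * y') • q + (z + t * z') • r by module, h]
      ring
  exact ⟨h0, h1⟩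

theorem IsTrinodalForm.coneCoeff_eq {F : MvPolynomial (Fin 3) ℂ} {p q r : Fin 3 → ℂ}
    {a b c d e f : ℂ} (h : IsTrinodalForm F p q r a b c d e f) (x y z : ℂ) :
    coneCoeff F p (x • p + y • q + z • r) = c * y ^ 2 + 2 * d * y * z + b * z ^ 2 :=
  (coeff_of_eval_eq (k₀ := 0) (k₁ := 0) (k₂ := c * y ^ 2 + 2 * d * y * z + b * z ^ 2)
    (k₃ := 2 * x * (c * y ^ 2 + b * z ^ 2 + 2 * d * y * z) + 2 * y * z * (e * y + f * z))
    (k₄ := a * y ^ 2 * z ^ 2 + b * x ^ 2 * z ^ 2 + c * x ^ 2 * y ^ 2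
        + 2 * x * y * z * (d * x + e * y + f * z)) fun t => by
      rw [eval_lineRest, show p + t • (x • p + y • q + z • r) =
        (1 + t * x) • p + (t * y) • q + (t * z) • r by module, h]
      ring).2.2

theorem exists_coords {p q r : Fin 3 → ℂ} (hI : LinearIndependent ℂ ![p, q, r])
    (w : Fin 3 → ℂ) : ∃ x y z : ℂ, w = x • p + y • q + z • r := by
  have hs := hI.span_eq_top_of_card_eq_finrank' (by simp)
  have hw : w ∈ Submodule.span ℂ (Set.range ![p, q, r]) := hs ▸ Submodule.mem_top
  obtain ⟨c, hc⟩ := (Submodule.mem_span_range_iff_exists_fun ℂ).mp hw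
  exact ⟨c 0, c 1, c 2, by rw [← hc]; simp [Fin.sum_univ_three]⟩

theorem coords_eq_zero {p q r : Fin 3 → ℂ} (hI : LinearIndependent ℂ ![p, q, r]) {x y z : ℂ}
    (h : x • p + y • q + z • r = 0) : x = 0 ∧ y = 0 ∧ z = 0 := by
  have := Fintype.linearIndependent_iff.mp hI ![x, y, z] (by simpa [Fin.sum_univ_three] using h)
  exact ⟨this 0, this 1, this 2⟩

theorem linearIndependent_rotate {p q r : Fin 3 → ℂ} (hI : LinearIndependent ℂ ![p, q, r]) :
    LinearIndependent ℂ ![q, r, p] := by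
  rw [Fintype.linearIndependent_iff]
  intro g hg
  simp only [Fin.sum_univ_three, Matrix.cons_val] at hg
  obtain ⟨h2, h0, h1⟩ := coords_eq_zero hI (x := g 2) (y := g 0) (z := g 1)
    (by rw [← hg]; abel)
  intro i
  fin_cases i <;> assumption

theorem IsTrinodalForm.sq_ne_of_ordinaryNode {F : MvPolynomial (Fin 3) ℂ} {n : ℕ}
    (hF : F.IsHomogeneous n) {p q r : Fin 3 → ℂ} {a b c d e f : ℂ}
    (h : IsTrinodalForm F p q r a b c d e f) (hI : LinearIndependent ℂ ![p, q, r])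
    (hp : p ≠ 0) (hnode : OrdinaryNode F (Projectivization.mk ℂ p hp)) : b * c - d ^ 2 ≠ 0 := by
  intro hdeg
  obtain ⟨⟨hs, hns⟩, hcone⟩ := hnode
  obtain ⟨b₁, b₂, hb, h₁, h₂⟩ := hcone p hp rfl
  obtain ⟨x₁, y₁, z₁, rfl⟩ := exists_coords hI b₁
  obtain ⟨x₂, y₂, z₂, rfl⟩ := exists_coords hI b₂
  rw [h.coneCoeff_eq] at h₁ h₂
  have hdet : y₁ * z₂ - y₂ * z₁ ≠ 0 := by
    intro h0
    have hz := (coords_eq_zero hb (x := x₂ * z₁ - x₁ * z₂) (y := z₂) (z := -z₁) (by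
      rw [show (x₂ * z₁ - x₁ * z₂) • p + z₂ • (x₁ • p + y₁ • q + z₁ • r)
        + -z₁ • (x₂ • p + y₂ • q + z₂ • r) = (y₁ * z₂ - y₂ * z₁) • q by module, h0, zero_smul])).2
    have hy := (coords_eq_zero hb (x := x₂ * y₁ - x₁ * y₂) (y := y₂) (z := -y₁) (by
      rw [show (x₂ * y₁ - x₁ * y₂) • p + y₂ • (x₁ • p + y₁ • q + z₁ • r)
        + -y₁ • (x₂ • p + y₂ • q + z₂ • r) = (-(y₁ * z₂ - y₂ * z₁)) • r by module, h0, neg_zero,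
        zero_smul])).2
    have := (coords_eq_zero hb (x := -x₁) (y := 1) (z := 0) (by
      rw [show z₁ = 0 by simpa using hz.2, show y₁ = 0 by simpa using hy.2]
      module)).2.1
    exact one_ne_zero this
  have hc1 : ∀ y z : ℂ, c * y ^ 2 + 2 * d * y * z + b * z ^ 2 = 0 →
      c * y + d * z = 0 ∧ d * y + b * z = 0 := by
    intro y z hyz
    constructor
    · refine pow_eq_zero_iff (two_ne_zero) |>.mp ?_
      linear_combination c * hyz - z ^ 2 * hdeg
    · refine pow_eq_zero_iff (two_ne_zero) |>.mp ?_
      linear_combination b * hyz - y ^ 2 * hdeg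
  obtain ⟨u₁, v₁⟩ := hc1 _ _ h₁
  obtain ⟨u₂, v₂⟩ := hc1 _ _ h₂
  have hc : c = 0 := (mul_eq_zero.mp (show (y₁ * z₂ - y₂ * z₁) * c = 0 by
    linear_combination z₂ * u₁ - z₁ * u₂)).resolve_left hdet
  have hd : d = 0 := (mul_eq_zero.mp (show (y₁ * z₂ - y₂ * z₁) * d = 0 by
    linear_combination z₂ * v₁ - z₁ * v₂)).resolve_left hdet
  have hb : b = 0 := (mul_eq_zero.mp (show (y₁ * z₂ - y₂ * z₁) * b = 0 by
    linear_combination -y₂ * v₁ + y₁ * v₂)).resolve_left hdet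
  refine hns (vanishesToOrder_three_of_coneCoeff hF hp hs fun w => ?_)
  obtain ⟨x, y, z, rfl⟩ := exists_coords hI w
  rw [h.coneCoeff_eq, hb, hc, hd]
  ring

/-- A trinodal quartic has no singular point off the three nodes. -/
theorem IsTrinodalForm.false_of_singular {F : MvPolynomial (Fin 3) ℂ} {n : ℕ}
    (hF : F.IsHomogeneous n) {p q r : Fin 3 → ℂ} {a b c d e f : ℂ}
    (h : IsTrinodalForm F p q r a b c d e f) (hI : LinearIndependent ℂ ![p, q, r])
    (hp : p ≠ 0) (hq : q ≠ 0) (hr : r ≠ 0)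
    (hsing : ∀ s : P2, IsSingularAt F s → s = Projectivization.mk ℂ p hp ∨
      s = Projectivization.mk ℂ q hq ∨ s = Projectivization.mk ℂ r hr)
    {x y z : ℂ} (hy : y ≠ 0) (hz : z ≠ 0)
    (h₀ : a * y ^ 2 * z ^ 2 + b * x ^ 2 * z ^ 2 + c * x ^ 2 * y ^ 2
        + 2 * x * y * z * (d * x + e * y + f * z) = 0)
    (h₁ : 2 * b * x * z ^ 2 + 2 * c * x * y ^ 2 + 2 * y * z * (2 * d * x + e * y + f * z) = 0)
    (h₂ : 2 * a * y * z ^ 2 + 2 * c * x ^ 2 * y + 2 * x * z * (d * x + 2 * e * y + f * z) = 0)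
    (h₃ : 2 * a * y ^ 2 * z + 2 * b * x ^ 2 * z + 2 * x * y * (d * x + e * y + 2 * f * z) = 0) :
    False := by
  have hw : x • p + y • q + z • r ≠ 0 := fun h0 => hy (coords_eq_zero hI h0).2.1
  have hs := hsing _ (isSingularAt_of_coeff hF hw fun v => by
    obtain ⟨x', y', z', rfl⟩ := exists_coords hI v
    obtain ⟨k₀, k₁⟩ := h.lineRest_coeff x y z x' y' z'
    rw [k₀, k₁, h₀, h₁, h₂, h₃]
    simp)
  simp only [Projectivization.mk_eq_mk_iff'] at hs
  obtain ⟨t, ht⟩ | ⟨t, ht⟩ | ⟨t, ht⟩ := hs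
  · exact hy (coords_eq_zero hI (x := x - t) (y := y) (z := z)
      (by rw [sub_smul, ht]; abel)).2.1
  · exact hz (coords_eq_zero hI (x := x) (y := y - t) (z := z)
      (by rw [sub_smul, ht]; abel)).2.2
  · exact hy (coords_eq_zero hI (x := x) (y := y) (z := z - t)
      (by rw [sub_smul, ht]; abel)).2.1

theorem mem_lineThrough_mk {u v w : Fin 3 → ℂ} (hw : w ≠ 0)
    (h : Projectivization.mk ℂ w hw ∈ lineThrough u v) : ∃ s t : ℂ, w = s • u + t • v := by
  obtain ⟨s, t, h0, hst⟩ := h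
  obtain ⟨c, rfl⟩ := (Projectivization.mk_eq_mk_iff' ℂ _ _ hw h0).mp hst
  exact ⟨c * s, c * t, by module⟩

theorem lineThrough_smul_add (p q : Fin 3 → ℂ) (s : ℂ) :
    lineThrough p q = lineThrough (s • p + q) p := by
  ext w
  constructor
  · rintro ⟨x, y, h, rfl⟩
    have e : x • p + y • q = y • (s • p + q) + (x - y * s) • p := by module
    exact ⟨y, x - y * s, e ▸ h, by simp only [e]⟩
  · rintro ⟨x, y, h, rfl⟩
    have e : x • (s • p + q) + y • p = (x * s + y) • p + x • q := by module
    exact ⟨x * s + y, x, e ▸ h, by simp only [e]⟩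

/-- A line through a double point is a theta-line exactly when the residual binary quadratic form
is degenerate, provided the latter does not vanish at `q`. -/
theorem thetaLine_lineThrough_iff {F : MvPolynomial (Fin 3) ℂ} {n : ℕ}
    (hF : F.IsHomogeneous n) {p q : Fin 3 → ℂ} (hI : LinearIndependent ℂ ![p, q]) {α β γ : ℂ}
    (h : ∀ s t : ℂ, eval (s • p + t • q) F =
      t ^ 2 * (α * s ^ 2 + 2 * β * s * t + γ * t ^ 2)) (hγ : γ ≠ 0) :
    ThetaLine F (lineThrough p q) ↔ β ^ 2 = α * γ := by
  have hpair := LinearIndependent.pair_iff.mp hI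
  constructor
  · rintro ⟨-, hsub | htan⟩
    · have hq : q ≠ 0 := hI.ne_zero 1
      have hmem : Projectivization.mk ℂ q hq ∈ lineThrough p q := ⟨0, 1, by simpa, by simp⟩
      have hq0 := hsub hmem q hq rfl
      have := h 0 1
      simp [hq0] at this
      exact absurd this.symm hγ
    · by_cases hαβ : α = 0 ∧ β = 0
      · simp [hαβ.1, hαβ.2]
      obtain ⟨s, hs⟩ : ∃ s : ℂ, α * s ^ 2 + 2 * β * s + γ = 0 := by
        by_cases hα : α = 0
        · have hβ : β ≠ 0 := fun hβ => hαβ ⟨hα, hβ⟩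
          refine ⟨-γ / (2 * β), ?_⟩
          rw [hα]
          field_simp
          ring
        · obtain ⟨δ, hδ⟩ := IsAlgClosed.exists_pow_nat_eq (β ^ 2 - α * γ) two_pos
          refine ⟨(-β + δ) / α, ?_⟩
          field_simp
          linear_combination hδ
      have hind : LinearIndependent ℂ ![s • p + q, p] := by
        rw [LinearIndependent.pair_iff]
        intro x y hxy
        obtain ⟨h1, h2⟩ := hpair (x * s + y) x (by rw [← hxy]; module)
        subst h2
        simpa using h1
      have ha : s • p + q ≠ 0 := hind.ne_zero 0
      have hroot : eval (s • p + q) F = 0 := by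
        have := h s 1
        rw [one_smul] at this
        rw [this]
        linear_combination hs
      have hm := htan _ _ hind (lineThrough_smul_add p q s) ha
        (mem_curve_of_eval_eq_zero hF ha hroot)
      have hdvd : (Polynomial.X : Polynomial ℂ) ^ 2 ∣ lineRest F (s • p + q) p := by
        have := (pow_dvd_pow _ hm).trans (Polynomial.pow_rootMultiplicity_dvd
          (lineRest F (s • p + q) p) 0)
        simpa using this
      have hc1 := Polynomial.X_pow_dvd_iff.mp hdvd 1 one_lt_two
      have hc := (coeff_of_eval_eq (P := lineRest F (s • p + q) p) (k₀ := 0)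
        (k₁ := 2 * (α * s + β)) (k₂ := α) (k₃ := 0) (k₄ := 0) fun t => by
          have := h (s + t) 1
          rw [eval_lineRest, show s • p + q + t • p = (s + t) • p + (1 : ℂ) • q by module, this]
          linear_combination hs).2.1
      have hlin : α * s + β = 0 := by
        have := hc.symm.trans hc1
        simpa using this
      linear_combination (α * s + β) * hlin - α * hs
  · intro hd
    refine ⟨⟨p, q, hI, rfl⟩, Or.inr ?_⟩
    intro u v huv hS hu hmem
    have hv : v ≠ 0 := huv.ne_zero 1
    have hu' : Projectivization.mk ℂ u hu ∈ lineThrough p q := by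
      rw [hS]
      exact ⟨1, 0, by simpa, by simp⟩
    have hv' : Projectivization.mk ℂ v hv ∈ lineThrough p q := by
      rw [hS]
      exact ⟨0, 1, by simpa, by simp⟩
    obtain ⟨s, t, rfl⟩ := mem_lineThrough_mk hu hu'
    obtain ⟨s', t', rfl⟩ := mem_lineThrough_mk hv hv'
    have hpair' := LinearIndependent.pair_iff.mp huv
    have hN1 : ¬ (t = 0 ∧ t' = 0) := by
      rintro ⟨rfl, rfl⟩
      have h1 := hpair' s' (-s) (by module)
      apply hu
      simp [neg_eq_zero.mp h1.2]
    set κ := β / γ with hκ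
    have hN2 : ¬ (t + κ * s = 0 ∧ t' + κ * s' = 0) := by
      rintro ⟨h1, h2⟩
      obtain rfl : t = -κ * s := by linear_combination h1
      obtain rfl : t' = -κ * s' := by linear_combination h2
      have h3 := hpair' s' (-s) (by module)
      apply hu
      simp [neg_eq_zero.mp h3.2]
    let N : Polynomial ℂ := (Polynomial.C t + Polynomial.C t' * Polynomial.X) *
      (Polynomial.C (t + κ * s) + Polynomial.C (t' + κ * s') * Polynomial.X)
    have hlin : ∀ x y : ℂ, ¬ (x = 0 ∧ y = 0) →
        (Polynomial.C x + Polynomial.C y * Polynomial.X : Polynomial ℂ) ≠ 0 := by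
      intro x y hxy h0
      refine hxy ⟨?_, ?_⟩
      · simpa using congrArg (fun P => Polynomial.coeff P 0) h0
      · simpa using congrArg (fun P => Polynomial.coeff P 1) h0
    have hN0 : N ≠ 0 := mul_ne_zero (hlin _ _ hN1) (hlin _ _ hN2)
    have hrest : lineRest F (s • p + t • q) (s' • p + t' • q) = Polynomial.C γ * N ^ 2 := by
      refine Polynomial.funext fun x => ?_
      rw [eval_lineRest, show s • p + t • q + x • (s' • p + t' • q) =
        (s + x * s') • p + (t + x * t') • q by module, h]
      simp only [N, Polynomial.eval_mul, Polynomial.eval_pow, Polynomial.eval_add,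
        Polynomial.eval_C, Polynomial.eval_X]
      have hβ : β = κ * γ := by rw [hκ]; field_simp
      have hα : α = κ ^ 2 * γ := mul_right_cancel₀ hγ (by rw [← hd, hβ]; ring)
      rw [hα, hβ]
      ring
    have hroot : eval (s • p + t • q) F = 0 := hmem _ hu rfl
    have hNX : Polynomial.X ∣ N := by
      rw [← coeff_zero_lineRest F _ (s' • p + t' • q), hrest, Polynomial.coeff_C_mul,
        Polynomial.coeff_zero_eq_eval_zero, Polynomial.eval_pow] at hroot
      rw [Polynomial.X_dvd_iff, Polynomial.coeff_zero_eq_eval_zero]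
      simpa [hγ] using hroot
    rw [multAt, Polynomial.le_rootMultiplicity_iff
      (by rw [hrest]; exact mul_ne_zero (by simpa using hγ) (pow_ne_zero 2 hN0)), hrest]
    simpa using (pow_dvd_pow_of_dvd hNX 2).mul_left (Polynomial.C γ)

theorem IsTrinodalForm.thetaLine_iff {F : MvPolynomial (Fin 3) ℂ} {n : ℕ}
    (hF : F.IsHomogeneous n) {p q r : Fin 3 → ℂ} {a b c d e f : ℂ}
    (h : IsTrinodalForm F p q r a b c d e f) (hI : LinearIndependent ℂ ![p, q, r])
    (ha : a ≠ 0) {m : ℂ} (hm : m ≠ 0) :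
    ThetaLine F (lineThrough p (m • q + r)) ↔
      (a * c - e ^ 2) * m ^ 2 + 2 * (a * d - e * f) * m + (a * b - f ^ 2) = 0 := by
  have hind : LinearIndependent ℂ ![p, m • q + r] := by
    rw [LinearIndependent.pair_iff]
    intro x y hxy
    have := coords_eq_zero hI (x := x) (y := y * m) (z := y) (by rw [← hxy]; module)
    exact ⟨this.1, this.2.2⟩
  rw [thetaLine_lineThrough_iff hF hind (α := b + c * m ^ 2 + 2 * d * m)
    (β := m * (e * m + f)) (γ := a * m ^ 2) (fun s t => by
      rw [show s • p + t • (m • q + r) = s • p + (t * m) • q + t • r by module, h]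
      ring) (mul_ne_zero ha (pow_ne_zero 2 hm))]
  constructor
  · intro h0
    refine (mul_eq_zero.mp (?_ : m ^ 2 * _ = 0)).resolve_left (pow_ne_zero 2 hm)
    linear_combination -h0
  · intro h0
    linear_combination -m ^ 2 * h0

theorem quadratic_proportional {A B C A' B' C' : ℂ} (hA : A ≠ 0) (hdisc : B ^ 2 - A * C ≠ 0)
    (h : ∀ m : ℂ, A * m ^ 2 + 2 * B * m + C = 0 → A' * m ^ 2 + 2 * B' * m + C' = 0) :
    A * B' = A' * B ∧ A * C' = A' * C := by
  obtain ⟨δ, hδ⟩ := IsAlgClosed.exists_pow_nat_eq (B ^ 2 - A * C) two_pos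
  have hδ0 : δ ≠ 0 := by
    rintro rfl
    exact hdisc (by simpa using hδ.symm)
  have h₁ := h ((-B + δ) / A) (by field_simp; linear_combination hδ)
  have h₂ := h ((-B - δ) / A) (by field_simp; linear_combination hδ)
  field_simp at h₁ h₂
  have hB : A * B' = A' * B := by
    refine mul_left_cancel₀ (mul_ne_zero (by norm_num : (4 : ℂ) ≠ 0) hδ0) ?_
    linear_combination h₁ - h₂
  refine ⟨hB, mul_left_cancel₀ hA ?_⟩
  linear_combination h₁ - A' * hδ + 2 * (B - δ) * hB

theorem IsTrinodalForm.coeff_ne_zero {F : MvPolynomial (Fin 3) ℂ} {n : ℕ}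
    (hF : F.IsHomogeneous n) {p q r : Fin 3 → ℂ} {a b c d e f : ℂ}
    (h : IsTrinodalForm F p q r a b c d e f) (hI : LinearIndependent ℂ ![p, q, r])
    (hp : p ≠ 0) (hq : q ≠ 0) (hr : r ≠ 0)
    (hsing : ∀ s : P2, IsSingularAt F s → s = Projectivization.mk ℂ p hp ∨
      s = Projectivization.mk ℂ q hq ∨ s = Projectivization.mk ℂ r hr)
    (h₂ : c * a - e ^ 2 ≠ 0) (h₃ : a * b - f ^ 2 ≠ 0) : a ≠ 0 := by
  rintro rfl
  have he : e ≠ 0 := by rintro rfl; simp at h₂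
  have hf : f ≠ 0 := by rintro rfl; simp at h₃
  refine h.false_of_singular hF hI hp hq hr hsing (x := 0) (y := f) (z := -e) hf
    (neg_ne_zero.mpr he) ?_ ?_ ?_ ?_ <;> ring

theorem IsTrinodalForm.det_ne_zero {F : MvPolynomial (Fin 3) ℂ} {n : ℕ}
    (hF : F.IsHomogeneous n) {p q r : Fin 3 → ℂ} {a b c d e f : ℂ}
    (h : IsTrinodalForm F p q r a b c d e f) (hI : LinearIndependent ℂ ![p, q, r])
    (hp : p ≠ 0) (hq : q ≠ 0) (hr : r ≠ 0)
    (hsing : ∀ s : P2, IsSingularAt F s → s = Projectivization.mk ℂ p hp ∨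
      s = Projectivization.mk ℂ q hq ∨ s = Projectivization.mk ℂ r hr)
    (h₁ : b * c - d ^ 2 ≠ 0) (h₂ : c * a - e ^ 2 ≠ 0) (h₃ : a * b - f ^ 2 ≠ 0) :
    a * b * c + 2 * d * e * f - a * d ^ 2 - b * e ^ 2 - c * f ^ 2 ≠ 0 := by
  intro hdet
  obtain ⟨v, hv0, hv⟩ := Matrix.exists_mulVec_eq_zero_iff
    (M := !![a, f, e; f, b, d; e, d, c]).mpr (by
      rw [Matrix.det_fin_three]; simp; linear_combination hdet)
  have e0 : a * v 0 + f * v 1 + e * v 2 = 0 := by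
    simpa [Matrix.mulVec, dotProduct, Fin.sum_univ_three] using congrFun hv 0
  have e1 : f * v 0 + b * v 1 + d * v 2 = 0 := by
    simpa [Matrix.mulVec, dotProduct, Fin.sum_univ_three] using congrFun hv 1
  have e2 : e * v 0 + d * v 1 + c * v 2 = 0 := by
    simpa [Matrix.mulVec, dotProduct, Fin.sum_univ_three] using congrFun hv 2
  have hne : ¬ (v 0 = 0 ∧ v 1 = 0 ∧ v 2 = 0) := by
    rintro ⟨k0, k1, k2⟩
    exact hv0 (by ext i; fin_cases i <;> assumption)
  generalize v 0 = u at *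
  generalize v 1 = v' at *
  generalize v 2 = w at *
  have hu : u ≠ 0 := by
    rintro rfl
    refine hne ⟨rfl, (mul_eq_zero.mp ?_).resolve_left h₁, (mul_eq_zero.mp ?_).resolve_left h₁⟩
    · linear_combination c * e1 - d * e2
    · linear_combination b * e2 - d * e1
  have hv' : v' ≠ 0 := by
    rintro rfl
    refine hne ⟨(mul_eq_zero.mp ?_).resolve_left h₂, rfl, (mul_eq_zero.mp ?_).resolve_left h₂⟩
    · linear_combination c * e0 - e * e2
    · linear_combination a * e2 - e * e0
  have hw : w ≠ 0 := by
    rintro rfl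
    refine hne ⟨(mul_eq_zero.mp ?_).resolve_left h₃, (mul_eq_zero.mp ?_).resolve_left h₃, rfl⟩
    · linear_combination b * e0 - f * e1
    · linear_combination a * e1 - f * e0
  refine h.false_of_singular hF hI hp hq hr hsing (x := v' * w) (y := u * w) (z := u * v')
    (mul_ne_zero hu hw) (mul_ne_zero hu hv') ?_ ?_ ?_ ?_
  · linear_combination u ^ 2 * v' ^ 2 * w ^ 2 * (u * e0 + v' * e1 + w * e2)
  · linear_combination 2 * u ^ 2 * v' * w * (v' * e1 + w * e2)
  · linear_combination 2 * u * v' ^ 2 * w * (u * e0 + w * e2)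
  · linear_combination 2 * u * v' * w ^ 2 * (u * e0 + v' * e1)

/-- The theta-lines through the node `p` determine the tangents from `p` to the conic. -/
theorem IsTrinodalForm.minors_proportional {F G : MvPolynomial (Fin 3) ℂ} {n n' : ℕ}
    (hF : F.IsHomogeneous n) (hG : G.IsHomogeneous n') {p q r : Fin 3 → ℂ}
    {a b c d e f a' b' c' d' e' f' : ℂ}
    (h : IsTrinodalForm F p q r a b c d e f) (h' : IsTrinodalForm G p q r a' b' c' d' e' f')
    (hI : LinearIndependent ℂ ![p, q, r]) (ha : a ≠ 0) (ha' : a' ≠ 0)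
    (hdet : a * b * c + 2 * d * e * f - a * d ^ 2 - b * e ^ 2 - c * f ^ 2 ≠ 0)
    (h₂ : c * a - e ^ 2 ≠ 0) (h₃ : a * b - f ^ 2 ≠ 0)
    (hsame : ∀ S, ThetaLine F S → ThetaLine G S) :
    (c * a - e ^ 2) * (a' * d' - e' * f') = (c' * a' - e' ^ 2) * (a * d - e * f) ∧
    (c * a - e ^ 2) * (a' * b' - f' ^ 2) = (c' * a' - e' ^ 2) * (a * b - f ^ 2) := by
  refine quadratic_proportional h₂ ?_ fun m hm => ?_
  · rw [show (a * d - e * f) ^ 2 - (c * a - e ^ 2) * (a * b - f ^ 2) =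
      -a * (a * b * c + 2 * d * e * f - a * d ^ 2 - b * e ^ 2 - c * f ^ 2) by ring]
    exact mul_ne_zero (neg_ne_zero.mpr ha) hdet
  · have hm0 : m ≠ 0 := by
      rintro rfl
      exact h₃ (by linear_combination hm)
    have := hsame _ ((h.thetaLine_iff hF hI ha hm0).mpr (by linear_combination hm))
    linear_combination (h'.thetaLine_iff hG hI ha' hm0).mp this

theorem linearIndependent_of_not_collin {p q r : Fin 3 → ℂ} (hp : p ≠ 0) (hq : q ≠ 0)
    (hr : r ≠ 0) (h : ¬ Collin (Projectivization.mk ℂ p hp) (Projectivization.mk ℂ q hq)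
      (Projectivization.mk ℂ r hr)) : LinearIndependent ℂ ![p, q, r] := by
  by_contra hdep
  have hspan : Submodule.span ℂ (Set.range ![p, q, r]) < ⊤ := by
    refine lt_top_iff_ne_top.mpr fun htop => hdep ?_
    exact linearIndependent_of_top_le_span_of_card_eq_finrank htop.ge (by simp)
  obtain ⟨φ, hφ, hker⟩ := Submodule.exists_le_ker_of_lt_top _ hspan
  have hrank : Module.finrank ℂ (LinearMap.ker φ) = 2 := by
    have h1 := LinearMap.finrank_range_add_finrank_ker φ
    rw [LinearMap.range_eq_top.mpr (LinearMap.surjective hφ)] at h1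
    simp at h1
    omega
  let B := Module.finBasisOfFinrankEq ℂ (LinearMap.ker φ) hrank
  have hmem : ∀ w (hw : w ≠ 0), w ∈ Set.range ![p, q, r] →
      Projectivization.mk ℂ w hw ∈ lineThrough (B 0 : Fin 3 → ℂ) (B 1) := by
    intro w hw hwr
    have hk : w ∈ LinearMap.ker φ := hker (Submodule.subset_span hwr)
    have hsum := congrArg Subtype.val (B.sum_repr ⟨w, hk⟩)
    simp only [Fin.sum_univ_two, Submodule.coe_add, Submodule.coe_smul] at hsum
    exact ⟨_, _, hsum.symm ▸ hw, by simp only [hsum]⟩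
  refine h ⟨_, ⟨B 0, B 1, ?_, rfl⟩, hmem p hp ⟨0, rfl⟩, hmem q hq ⟨1, rfl⟩, hmem r hr ⟨2, rfl⟩⟩
  have := B.linearIndependent.map' (LinearMap.ker φ).subtype (Submodule.ker_subtype _)
  rwa [show ![(B 0 : Fin 3 → ℂ), B 1] = (LinearMap.ker φ).subtype ∘ B by
    funext i
    fin_cases i <;> rfl]

theorem exists_ne_zero_scalar_of_minors {a b c d e f a' b' c' d' e' f' : ℂ}
    (hdet : a * b * c + 2 * d * e * f - a * d ^ 2 - b * e ^ 2 - c * f ^ 2 ≠ 0)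
    (hdet' : a' * b' * c' + 2 * d' * e' * f' - a' * d' ^ 2 - b' * e' ^ 2 - c' * f' ^ 2 ≠ 0)
    {l : ℂ} (hl : l ≠ 0)
    (h₁₁ : b' * c' - d' ^ 2 = l * (b * c - d ^ 2))
    (h₂₂ : c' * a' - e' ^ 2 = l * (c * a - e ^ 2))
    (h₃₃ : a' * b' - f' ^ 2 = l * (a * b - f ^ 2))
    (h₂₃ : a' * d' - e' * f' = l * (a * d - e * f))
    (h₁₃ : b' * e' - f' * d' = l * (b * e - f * d))
    (h₁₂ : c' * f' - d' * e' = l * (c * f - d * e)) :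
    ∃ k : ℂ, k ≠ 0 ∧ a' = k * a ∧ b' = k * b ∧ c' = k * c ∧ d' = k * d ∧ e' = k * e ∧
      f' = k * f := by
  set D := a * b * c + 2 * d * e * f - a * d ^ 2 - b * e ^ 2 - c * f ^ 2 with hD
  set D' := a' * b' * c' + 2 * d' * e' * f' - a' * d' ^ 2 - b' * e' ^ 2 - c' * f' ^ 2 with hD'
  have key : ∀ {x y x' y' : ℂ}, D' * x' = y' → D * x = y → y' = l ^ 2 * y →
      x' = l ^ 2 * D / D' * x := by
    intro x y x' y' h1 h2 h3
    field_simp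
    linear_combination h1 - l ^ 2 * h2 + h3
  refine ⟨l ^ 2 * D / D', div_ne_zero (mul_ne_zero (pow_ne_zero 2 hl) hdet) hdet',
    key (y' := (c' * a' - e' ^ 2) * (a' * b' - f' ^ 2) - (a' * d' - e' * f') ^ 2)
      (y := (c * a - e ^ 2) * (a * b - f ^ 2) - (a * d - e * f) ^ 2) ?_ ?_ ?_,
    key (y' := (b' * c' - d' ^ 2) * (a' * b' - f' ^ 2) - (b' * e' - f' * d') ^ 2)
      (y := (b * c - d ^ 2) * (a * b - f ^ 2) - (b * e - f * d) ^ 2) ?_ ?_ ?_,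
    key (y' := (b' * c' - d' ^ 2) * (c' * a' - e' ^ 2) - (c' * f' - d' * e') ^ 2)
      (y := (b * c - d ^ 2) * (c * a - e ^ 2) - (c * f - d * e) ^ 2) ?_ ?_ ?_,
    key (y' := (b' * c' - d' ^ 2) * (a' * d' - e' * f')
        + (c' * f' - d' * e') * (b' * e' - f' * d'))
      (y := (b * c - d ^ 2) * (a * d - e * f) + (c * f - d * e) * (b * e - f * d)) ?_ ?_ ?_,
    key (y' := (c' * a' - e' ^ 2) * (b' * e' - f' * d')
        + (a' * d' - e' * f') * (c' * f' - d' * e'))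
      (y := (c * a - e ^ 2) * (b * e - f * d) + (a * d - e * f) * (c * f - d * e)) ?_ ?_ ?_,
    key (y' := (a' * b' - f' ^ 2) * (c' * f' - d' * e')
        + (b' * e' - f' * d') * (a' * d' - e' * f'))
      (y := (a * b - f ^ 2) * (c * f - d * e) + (b * e - f * d) * (a * d - e * f)) ?_ ?_ ?_⟩
  all_goals first
    | (rw [hD']; ring)
    | (rw [hD]; ring)
    | (simp only [h₁₁, h₂₂, h₃₃, h₂₃, h₁₃, h₁₂]; ring)

/-- Two irreducible trinodal plane quartics having ordinary nodes at
the same three non-collinear points and the same set of theta-lines coincide. -/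
theorem trinodal_theta_property
    (n₁ n₂ n₃ : P2) (hncol : ¬ Collin n₁ n₂ n₃)
    (F G : MvPolynomial (Fin 3) ℂ)
    (hF4 : F.IsHomogeneous 4) (hFirr : Irreducible F)
    (hG4 : G.IsHomogeneous 4) (hGirr : Irreducible G)
    (hFn₁ : OrdinaryNode F n₁) (hFn₂ : OrdinaryNode F n₂) (hFn₃ : OrdinaryNode F n₃)
    (hFsing : ∀ q : P2, IsSingularAt F q → q = n₁ ∨ q = n₂ ∨ q = n₃)
    (hGn₁ : OrdinaryNode G n₁) (hGn₂ : OrdinaryNode G n₂) (hGn₃ : OrdinaryNode G n₃)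
    (hGsing : ∀ q : P2, IsSingularAt G q → q = n₁ ∨ q = n₂ ∨ q = n₃)
    (hsame : {S : Set P2 | ThetaLine F S} = {S : Set P2 | ThetaLine G S}) :
    ∃ c : ℂ, c ≠ 0 ∧ G = c • F := by
  induction n₁ using Projectivization.ind with | _ p hp
  induction n₂ using Projectivization.ind with | _ q hq
  induction n₃ using Projectivization.ind with | _ r hr
  have hI := linearIndependent_of_not_collin hp hq hr hncol
  have hI₂ := linearIndependent_rotate hI
  have hI₃ := linearIndependent_rotate hI₂
  have rot {H : MvPolynomial (Fin 3) ℂ} {s t u : P2}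
      (hs : ∀ x : P2, IsSingularAt H x → x = s ∨ x = t ∨ x = u) :
      ∀ x : P2, IsSingularAt H x → x = t ∨ x = u ∨ x = s := fun x hx => by
    have := hs x hx
    tauto
  obtain ⟨a, b, c, d, e, f, hF⟩ := exists_isTrinodalForm hF4 hp hq hr hFn₁.1.1 hFn₂.1.1 hFn₃.1.1
  obtain ⟨a', b', c', d', e', f', hG⟩ :=
    exists_isTrinodalForm hG4 hp hq hr hGn₁.1.1 hGn₂.1.1 hGn₃.1.1
  have m₁ := hF.sq_ne_of_ordinaryNode hF4 hI hp hFn₁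
  have m₂ := hF.rotate.sq_ne_of_ordinaryNode hF4 hI₂ hq hFn₂
  have m₃ := hF.rotate.rotate.sq_ne_of_ordinaryNode hF4 hI₃ hr hFn₃
  have m₁' := hG.sq_ne_of_ordinaryNode hG4 hI hp hGn₁
  have m₂' := hG.rotate.sq_ne_of_ordinaryNode hG4 hI₂ hq hGn₂
  have m₃' := hG.rotate.rotate.sq_ne_of_ordinaryNode hG4 hI₃ hr hGn₃
  have ha := hF.coeff_ne_zero hF4 hI hp hq hr hFsing m₂ m₃
  have hb := hF.rotate.coeff_ne_zero hF4 hI₂ hq hr hp (rot hFsing) m₃ m₁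
  have ha' := hG.coeff_ne_zero hG4 hI hp hq hr hGsing m₂' m₃'
  have hb' := hG.rotate.coeff_ne_zero hG4 hI₂ hq hr hp (rot hGsing) m₃' m₁'
  have hc := hF.rotate.rotate.coeff_ne_zero hF4 hI₃ hr hp hq (rot (rot hFsing)) m₁ m₂
  have hc' := hG.rotate.rotate.coeff_ne_zero hG4 hI₃ hr hp hq (rot (rot hGsing)) m₁' m₂'
  have hD := hF.det_ne_zero hF4 hI hp hq hr hFsing m₁ m₂ m₃
  have hD' := hG.det_ne_zero hG4 hI hp hq hr hGsing m₁' m₂' m₃'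
  have hsub : ∀ S, ThetaLine F S → ThetaLine G S := fun S hS => hsame.subset hS
  obtain ⟨r₁, s₁⟩ := hF.minors_proportional hF4 hG4 hG hI ha ha' hD m₂ m₃ hsub
  obtain ⟨r₂, s₂⟩ := hF.rotate.minors_proportional hF4 hG4 hG.rotate hI₂ hb hb'
    (by convert hD using 1; ring) m₃ m₁ hsub
  obtain ⟨r₃, -⟩ := hF.rotate.rotate.minors_proportional hF4 hG4 hG.rotate.rotate hI₃ hc hc'
    (by convert hD using 1; ring) m₁ m₂ hsub
  have hl : (c' * a' - e' ^ 2) / (c * a - e ^ 2) ≠ 0 := div_ne_zero m₂' m₂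
  have t₃ : a' * b' - f' ^ 2 = (c' * a' - e' ^ 2) / (c * a - e ^ 2) * (a * b - f ^ 2) := by
    field_simp
    linear_combination s₁
  have t₁ : b' * c' - d' ^ 2 = (c' * a' - e' ^ 2) / (c * a - e ^ 2) * (b * c - d ^ 2) := by
    rw [t₃] at s₂
    exact mul_left_cancel₀ m₃ (by linear_combination s₂)
  rw [t₃] at r₂
  rw [t₁] at r₃
  obtain ⟨k, hk, rfl, rfl, rfl, rfl, rfl, rfl⟩ := exists_ne_zero_scalar_of_minors hD hD' hl
    t₁ (by field_simp) t₃ (by field_simp; linear_combination r₁)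
    (mul_left_cancel₀ m₃ (by linear_combination r₂))
    (mul_left_cancel₀ m₁ (by linear_combination r₃))
  refine ⟨k, hk, MvPolynomial.funext fun w => ?_⟩
  obtain ⟨x, y, z, rfl⟩ := exists_coords hI w
  rw [MvPolynomial.smul_eval, hF, hG]
  ring


end
end
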